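/- arXiv:1401.0638 — 5 statements merged into one kernel-verified Lean document; each statement's English description precedes it below -/
import Mathlib

section
/- For all integers k ≥ 1 and n ≥ 1, the sum H(n,k) = Σ_{r=1}^{n} r^{2k}/(4r² − 1) satisfies H(n,k) = 4^{1−k} · n(n+1)/(2(2n+1)) + Σ_{j=1}^{2k−1} ν_j^k n^{2k−j}, where the coefficients are given explicitly by: ν_{2j}^k = 1/2^{2j+1} for 1 ≤ j ≤ k−1; ν_{2j+1}^k = (1/Γ(2k−2j)) Σ_{p=1}^{j+1} Γ(2k−2p+1) B_{2j−2p+2} / (Γ(2j−2p+3) · 4^p) for 0 ≤ j ≤ k−2; and ν_{2k−1}^k = Σ_{p=1}^{k−1} B_{2k−2p}/4^p. (For k = 1 the sum Σ_{j=1}^{2k−1} ν_j^k n^{2k−j} reduces to the single term ν_1^1 n with ν_1^1 = 0, i.e. it vanishes.) -/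
open Real Filter Finset

/-- The coefficients `ν_j^k` from Lemma 2.1: `ν_{2j'}^k = 1/2^{2j'+1}` for even indices,
`ν_{2j'+1}^k` given via Bernoulli numbers and Gamma functions for odd indices `< 2k-1`,
and `ν_{2k-1}^k = Σ_{p=1}^{k-1} B_{2k-2p}/4^p`. -/
noncomputable def nuCoeff (k j : ℕ) : ℝ :=
  if j = 2 * k - 1 then
    ∑ p ∈ Finset.Icc 1 (k - 1), (bernoulli (2 * k - 2 * p) : ℝ) / 4 ^ p
  else if j % 2 = 0 then
    1 / 2 ^ (j + 1)
  else
    (1 / Real.Gamma (2 * (k : ℝ) - (j : ℝ) + 1)) *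
      ∑ p ∈ Finset.Icc 1 ((j - 1) / 2 + 1),
        Real.Gamma (2 * (k : ℝ) - 2 * (p : ℝ) + 1) * (bernoulli (j + 1 - 2 * p) : ℝ) /
          (Real.Gamma ((j : ℝ) + 2 - 2 * (p : ℝ)) * 4 ^ p)

lemma sum_range_two_mul_add_one {M : Type*} [AddCommMonoid M] (f : ℕ → M) (N : ℕ) :
    ∑ i ∈ range (2 * N + 1), f i =
      ∑ i ∈ range (N + 1), f (2 * i) + ∑ i ∈ range N, f (2 * i + 1) := by
  induction N with
  | zero => simp
  | succ N ih =>
    rw [show 2 * (N + 1) + 1 = 2 * N + 1 + 1 + 1 by ring, sum_range_succ, sum_range_succ, ih,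
      sum_range_succ (fun i => f (2 * i)) (N + 1), sum_range_succ (fun i => f (2 * i + 1)) N,
      show 2 * (N + 1) = 2 * N + 1 + 1 by ring]
    abel

/-- The coefficient of `n ^ (m + 1 - t)` in `∑_{r=1}^n r ^ m`, for `t ≠ 1`. -/
noncomputable def powerSumCoeff (m t : ℕ) : ℝ :=
  (bernoulli t : ℝ) * (m.factorial : ℝ) / ((t.factorial : ℝ) * ((m + 1 - t).factorial : ℝ))

lemma powerSumCoeff_eq_choose {m t : ℕ} (h : t ≤ m + 1) :
    powerSumCoeff m t = (bernoulli t : ℝ) * ((m + 1).choose t : ℝ) / ((m : ℝ) + 1) := by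
  have hc : (((m + 1).choose t : ℕ) : ℝ) * (t.factorial : ℝ) * ((m + 1 - t).factorial : ℝ) =
      ((m : ℝ) + 1) * (m.factorial : ℝ) := by
    exact_mod_cast (Nat.choose_mul_factorial_mul_factorial h).trans (Nat.factorial_succ m)
  have h1 : (t.factorial : ℝ) ≠ 0 := by positivity
  have h2 : ((m + 1 - t).factorial : ℝ) ≠ 0 := by positivity
  have h3 : (m : ℝ) + 1 ≠ 0 := by positivity
  rw [powerSumCoeff, div_eq_div_iff (mul_ne_zero h1 h2) h3]
  linear_combination -(bernoulli t : ℝ) * hc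

lemma sum_Icc_pow_even (m n : ℕ) :
    ∑ r ∈ Icc 1 n, (r : ℝ) ^ (2 * m + 2) =
      ∑ i ∈ range (m + 2), powerSumCoeff (2 * m + 2) (2 * i) * (n : ℝ) ^ (2 * m + 3 - 2 * i) +
        (n : ℝ) ^ (2 * m + 2) / 2 := by
  have h := congrArg (Rat.cast : ℚ → ℝ) (sum_Ico_pow n (2 * m + 2))
  push_cast at h
  rw [show 2 * m + 2 + 1 = 2 * (m + 1) + 1 by ring, sum_range_two_mul_add_one,
    sum_range_succ' _ m] at h
  rw [← Finset.Ico_add_one_right_eq_Icc, h]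
  congr 1
  · refine sum_congr rfl fun i hi => ?_
    rw [mem_range] at hi
    rw [powerSumCoeff_eq_choose (by omega), bernoulli_eq_bernoulli'_of_ne_one (by omega)]
    push_cast
    rw [show 2 * (m + 1) + 1 - 2 * i = 2 * m + 3 - 2 * i by omega,
      show 2 * (m + 1) + 1 = 2 * m + 2 + 1 by ring]
    ring
  · rw [sum_eq_zero fun i _ => by
      rw [bernoulli'_eq_zero_of_odd (n := 2 * (i + 1) + 1) ⟨i + 1, rfl⟩ (by omega)]; simp]
    have h3 : (2 * (m : ℝ) + 2 + 1) ≠ 0 := by positivity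
    simp only [mul_zero, zero_add, bernoulli'_one, Nat.choose_one_right, Nat.add_sub_cancel]
    push_cast
    field_simp
    ring_nf

lemma nuCoeff_even {k i : ℕ} : nuCoeff k (2 * i + 2) = 1 / 2 ^ (2 * i + 3) := by
  rw [nuCoeff, if_neg (by omega), if_pos (by omega)]

lemma nuCoeff_odd {m i : ℕ} (h : i ≤ m) :
    nuCoeff (m + 1) (2 * i + 1) =
      ∑ q ∈ range (min (i + 1) m), powerSumCoeff (2 * m - 2 * q) (2 * i - 2 * q) / 4 ^ (q + 1) := by
  rw [nuCoeff]
  split_ifs with h1 h2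
  · obtain rfl : i = m := by omega
    rw [min_eq_right (by omega), Nat.add_sub_cancel, ← Finset.Ico_add_one_right_eq_Icc,
      Finset.sum_Ico_eq_sum_range, Nat.add_sub_cancel]
    refine sum_congr rfl fun q hq => ?_
    rw [mem_range] at hq
    rw [powerSumCoeff, show 2 * (i + 1) - 2 * (1 + q) = 2 * i - 2 * q by omega,
      show 2 * i - 2 * q + 1 - (2 * i - 2 * q) = 1 by omega, add_comm 1 q]
    have : ((2 * i - 2 * q).factorial : ℝ) ≠ 0 := by positivity
    simp [this]
  · omega
  · rw [min_eq_left (by omega), show (2 * i + 1 - 1) / 2 + 1 = i + 1 by omega,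
      ← Finset.Ico_add_one_right_eq_Icc, Finset.sum_Ico_eq_sum_range, Nat.add_sub_cancel, mul_sum]
    refine sum_congr rfl fun q hq => ?_
    rw [mem_range] at hq
    obtain ⟨a, rfl⟩ : ∃ a, i = q + a := ⟨i - q, by omega⟩
    obtain ⟨b, rfl⟩ : ∃ b, m = q + a + b := ⟨m - (q + a), by omega⟩
    rw [powerSumCoeff, show 2 * (q + a) + 1 + 1 - 2 * (1 + q) = 2 * a by omega,
      show 2 * (q + a) - 2 * q = 2 * a by omega,
      show 2 * (q + a + b) - 2 * q = 2 * a + 2 * b by omega,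
      show 2 * a + 2 * b + 1 - 2 * a = 2 * b + 1 by omega, add_comm 1 q,
      ← Real.Gamma_nat_eq_factorial, ← Real.Gamma_nat_eq_factorial, ← Real.Gamma_nat_eq_factorial]
    push_cast
    ring_nf

lemma nuCoeff_one (m : ℕ) : nuCoeff (m + 2) 1 = powerSumCoeff (2 * m + 2) 0 / 4 := by
  simpa [mul_add] using nuCoeff_odd (m := m + 1) (i := 0) (by omega)

lemma nuCoeff_odd_succ {m i : ℕ} (h : i ≤ m) :
    nuCoeff (m + 2) (2 * i + 3) =
      (powerSumCoeff (2 * m + 2) (2 * i + 2) + nuCoeff (m + 1) (2 * i + 1)) / 4 := by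
  rw [show 2 * i + 3 = 2 * (i + 1) + 1 by ring, nuCoeff_odd (by omega), nuCoeff_odd h,
    show min (i + 1 + 1) (m + 1) = min (i + 1) m + 1 by omega, sum_range_succ', add_comm, add_div,
    sum_div]
  congr 1
  · simp [mul_add]
  · refine sum_congr rfl fun q _ => ?_
    rw [show 2 * (m + 1) - 2 * (q + 1) = 2 * m - 2 * q by omega,
      show 2 * (i + 1) - 2 * (q + 1) = 2 * i - 2 * q by omega, pow_succ _ (q + 1), div_mul_eq_div_div]

lemma sum_nuCoeff_split (m : ℕ) (x : ℝ) :
    ∑ j ∈ Icc 1 (2 * (m + 1) - 1), nuCoeff (m + 1) j * x ^ (2 * (m + 1) - j) =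
      ∑ i ∈ range (m + 1), nuCoeff (m + 1) (2 * i + 1) * x ^ (2 * m + 1 - 2 * i) +
        ∑ i ∈ range m, 1 / 2 ^ (2 * i + 3) * x ^ (2 * m - 2 * i) := by
  rw [← Finset.Ico_add_one_right_eq_Icc, Finset.sum_Ico_eq_sum_range,
    show 2 * (m + 1) - 1 + 1 - 1 = 2 * m + 1 by omega, sum_range_two_mul_add_one]
  congr 1 <;> refine sum_congr rfl fun i _ => ?_
  · rw [add_comm 1, show 2 * (m + 1) - (2 * i + 1) = 2 * m + 1 - 2 * i by omega]
  · rw [show 1 + (2 * i + 1) = 2 * i + 2 by ring, nuCoeff_even,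
      show 2 * (m + 1) - (2 * i + 2) = 2 * m - 2 * i by omega]

lemma sum_nuCoeff_succ (m n : ℕ) :
    ∑ j ∈ Icc 1 (2 * (m + 2) - 1), nuCoeff (m + 2) j * (n : ℝ) ^ (2 * (m + 2) - j) =
      (∑ r ∈ Icc 1 n, (r : ℝ) ^ (2 * m + 2) +
        ∑ j ∈ Icc 1 (2 * (m + 1) - 1), nuCoeff (m + 1) j * (n : ℝ) ^ (2 * (m + 1) - j)) / 4 := by
  have hodd : ∑ i ∈ range (m + 1),
        nuCoeff (m + 2) (2 * (i + 1) + 1) * (n : ℝ) ^ (2 * (m + 1) + 1 - 2 * (i + 1)) =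
      (∑ i ∈ range (m + 1),
          powerSumCoeff (2 * m + 2) (2 * (i + 1)) * (n : ℝ) ^ (2 * m + 3 - 2 * (i + 1)) +
        ∑ i ∈ range (m + 1), nuCoeff (m + 1) (2 * i + 1) * (n : ℝ) ^ (2 * m + 1 - 2 * i)) / 4 := by
    rw [← sum_add_distrib, sum_div]
    refine sum_congr rfl fun i hi => ?_
    rw [mem_range] at hi
    rw [show 2 * (i + 1) + 1 = 2 * i + 3 by ring, nuCoeff_odd_succ (by omega),
      show 2 * (m + 1) + 1 - 2 * (i + 1) = 2 * m + 1 - 2 * i by omega,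
      show 2 * m + 3 - 2 * (i + 1) = 2 * m + 1 - 2 * i by omega]
    ring_nf
  have heven : ∑ i ∈ range m,
        1 / 2 ^ (2 * (i + 1) + 3) * (n : ℝ) ^ (2 * (m + 1) - 2 * (i + 1)) =
      (∑ i ∈ range m, 1 / 2 ^ (2 * i + 3) * (n : ℝ) ^ (2 * m - 2 * i)) / 4 := by
    rw [sum_div]
    refine sum_congr rfl fun i _ => ?_
    rw [show 2 * (m + 1) - 2 * (i + 1) = 2 * m - 2 * i by omega]
    ring
  rw [sum_nuCoeff_split (m + 1), sum_nuCoeff_split m, sum_Icc_pow_even, sum_range_succ' _ (m + 1),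
    sum_range_succ' (fun i => 1 / 2 ^ (2 * i + 3) * (n : ℝ) ^ (2 * (m + 1) - 2 * i)) m,
    sum_range_succ' _ (m + 1), hodd, heven, mul_zero, zero_add, nuCoeff_one]
  simp only [Nat.sub_zero, mul_add, mul_one]
  ring

lemma four_mul_sq_sub_one_ne_zero {r : ℕ} : 4 * (r : ℝ) ^ 2 - 1 ≠ 0 := by
  intro h
  have : 4 * r ^ 2 = 1 := by exact_mod_cast sub_eq_zero.mp h
  omega

lemma sum_sq_div_four_sq_sub_one (n : ℕ) :
    ∑ r ∈ Icc 1 n, (r : ℝ) ^ 2 / (4 * (r : ℝ) ^ 2 - 1) =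
      (n : ℝ) * ((n : ℝ) + 1) / (2 * (2 * (n : ℝ) + 1)) := by
  induction n with
  | zero => simp
  | succ n ih =>
    rw [sum_Icc_succ_top (by omega), ih]
    push_cast
    rw [show 4 * ((n : ℝ) + 1) ^ 2 - 1 = (2 * n + 1) * (2 * (n + 1) + 1) by ring]
    have h1 : 2 * (n : ℝ) + 1 ≠ 0 := by positivity
    have h2 : 2 * ((n : ℝ) + 1) + 1 ≠ 0 := by positivity
    field_simp
    ring

lemma sum_pow_succ_div_four_sq_sub_one (k n : ℕ) :
    ∑ r ∈ Icc 1 n, (r : ℝ) ^ (2 * k + 2) / (4 * (r : ℝ) ^ 2 - 1) =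
      (∑ r ∈ Icc 1 n, (r : ℝ) ^ (2 * k) +
        ∑ r ∈ Icc 1 n, (r : ℝ) ^ (2 * k) / (4 * (r : ℝ) ^ 2 - 1)) / 4 := by
  rw [← sum_add_distrib, sum_div]
  refine sum_congr rfl fun r _ => ?_
  have h0 := four_mul_sq_sub_one_ne_zero (r := r)
  field_simp
  ring

/-- For all integers `k ≥ 1` and `n ≥ 1`,
`Σ_{r=1}^{n} r^{2k}/(4r² − 1) = 4^{1−k}·n(n+1)/(2(2n+1)) + Σ_{j=1}^{2k−1} ν_j^k n^{2k−j}`. -/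
theorem sum_pow_div_four_sq_sub_one (k n : ℕ) (hk : 1 ≤ k) (hn : 1 ≤ n) :
    ∑ r ∈ Finset.Icc 1 n, (r : ℝ) ^ (2 * k) / (4 * (r : ℝ) ^ 2 - 1) =
      (1 / 4 ^ (k - 1)) * ((n : ℝ) * ((n : ℝ) + 1) / (2 * (2 * (n : ℝ) + 1))) +
        ∑ j ∈ Finset.Icc 1 (2 * k - 1), nuCoeff k j * (n : ℝ) ^ (2 * k - j) := by
  obtain ⟨m, rfl⟩ : ∃ m, k = m + 1 := ⟨k - 1, by omega⟩
  clear hk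
  induction m with
  | zero => simpa [nuCoeff] using sum_sq_div_four_sq_sub_one n
  | succ m ih =>
    rw [sum_nuCoeff_succ, show 2 * (m + 1 + 1) = 2 * (m + 1) + 2 by ring,
      sum_pow_succ_div_four_sq_sub_one, ih, Nat.add_sub_cancel, Nat.add_sub_cancel, pow_succ,
      show 2 * (m + 1) = 2 * m + 2 by ring]
    ring
end

section
/- Let f be continuous on [−1,1] and let s > 0. Suppose the Chebyshev coefficients of f satisfy, for some constant c(s) independent of m and some m_0, either a_m = c(s)/m^{s+1} + O(m^{−s−2}) for m ≥ m_0, or a_m = (−1)^m c(s)/m^{s+1} + O(m^{−s−2}) for m ≥ m_0. Then the error of the (n+1)-point Clenshaw–Curtis quadrature rule satisfies E_n^C[f] = O(n^{−s−2}) as n → ∞. -/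
open Real Filter Finset

/-- The Chebyshev coefficients of `f : [-1,1] → ℝ`:
`a_k = (2/π) ∫_0^π f(cos t) cos(kt) dt`. -/
noncomputable def chebCoeff (f : ℝ → ℝ) (k : ℕ) : ℝ :=
  (2 / π) * ∫ t in (0 : ℝ)..π, f (Real.cos t) * Real.cos ((k : ℝ) * t)

/-- `δ_j = 1/2` if `j = 0` or `j = n`, and `δ_j = 1` otherwise. -/
noncomputable def ccDelta (n j : ℕ) : ℝ := if j = 0 ∨ j = n then 1 / 2 else 1

/-- The Clenshaw–Curtis quadrature weights
`w_j = (4δ_j/n) Σ_{k=0}^{⌊n/2⌋} δ_{2k} cos(2jkπ/n)/(1−4k²)`. -/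
noncomputable def ccWeight (n j : ℕ) : ℝ :=
  (4 * ccDelta n j / (n : ℝ)) * ∑ k ∈ Finset.range (n / 2 + 1),
    ccDelta n (2 * k) * Real.cos (2 * (j : ℝ) * (k : ℝ) * π / (n : ℝ)) / (1 - 4 * (k : ℝ) ^ 2)

/-- The `(n+1)`-point Clenshaw–Curtis quadrature rule
`I_n^C[f] = Σ_{j=0}^{n} w_j f(cos(jπ/n))`. -/
noncomputable def ccQuad (f : ℝ → ℝ) (n : ℕ) : ℝ :=
  ∑ j ∈ Finset.range (n + 1), ccWeight n j * f (Real.cos ((j : ℝ) * π / (n : ℝ)))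

/-- The Clenshaw–Curtis quadrature error `E_n^C[f] = ∫_{-1}^1 f − I_n^C[f]`. -/
noncomputable def ccError (f : ℝ → ℝ) (n : ℕ) : ℝ :=
  (∫ x in (-1 : ℝ)..1, f x) - ccQuad f n

lemma continuous_comp_cos {f : ℝ → ℝ} (hf : ContinuousOn f (Set.Icc (-1) 1)) :
    Continuous fun t : ℝ => f (Real.cos t) :=
  hf.comp_continuous Real.continuous_cos fun t => ⟨Real.neg_one_le_cos t, Real.cos_le_one t⟩

lemma integral_exp_mul_comp_cos {f : ℝ → ℝ} (hf : ContinuousOn f (Set.Icc (-1) 1)) (n : ℤ) :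
    ∫ t in (-π)..π, Complex.exp (-(Complex.I * n * t)) * (f (Real.cos t) : ℂ) =
      ((π * chebCoeff f n.natAbs : ℝ) : ℂ) := by
  have hg := continuous_comp_cos hf
  set g : ℝ → ℂ := fun t => Complex.exp (-(Complex.I * n * t)) * (f (Real.cos t) : ℂ) with hg_def
  have hgc : Continuous g := by
    have : Continuous fun t : ℝ => ((f (Real.cos t) : ℝ) : ℂ) := Complex.continuous_ofReal.comp hg
    fun_prop
  rw [← intervalIntegral.integral_add_adjacent_intervals (b := 0)
    (hgc.intervalIntegrable _ _) (hgc.intervalIntegrable _ _)]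
  have h1 : ∫ t in (-π)..0, g t = ∫ t in (0 : ℝ)..π, g (-t) := by
    rw [intervalIntegral.integral_comp_neg]; simp
  have hgn : Continuous fun t => g (-t) := hgc.comp continuous_neg
  rw [h1, ← intervalIntegral.integral_add (hgn.intervalIntegrable _ _)
    (hgc.intervalIntegrable _ _)]
  have h2 : ∀ t : ℝ, g (-t) + g t =
      ((2 * (f (Real.cos t) * Real.cos ((n.natAbs : ℝ) * t)) : ℝ) : ℂ) := by
    intro t
    have h3 : Real.cos ((n.natAbs : ℝ) * t) = Real.cos (n * t) := by
      rw [Nat.cast_natAbs, Int.cast_abs]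
      rcases abs_choice (n : ℝ) with h | h <;> rw [h]
      rw [neg_mul, Real.cos_neg]
    rw [h3, hg_def]
    push_cast
    rw [Complex.cos]
    simp only [Real.cos_neg]
    rw [show -(Complex.I * n * -(t : ℂ)) = n * t * Complex.I by ring,
      show -(Complex.I * n * (t : ℂ)) = -(n * t) * Complex.I by ring]
    ring
  simp_rw [h2]
  rw [intervalIntegral.integral_ofReal, intervalIntegral.integral_const_mul, chebCoeff]
  congr 1
  field_simp

/-- A continuous function with summable Chebyshev coefficients is the sum of its Chebyshev
series. -/
lemma hasSum_chebCoeff_mul_cos {f : ℝ → ℝ} (hf : ContinuousOn f (Set.Icc (-1) 1))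
    (hs : Summable (chebCoeff f)) (t : ℝ) :
    HasSum (fun m : ℤ => chebCoeff f m.natAbs / 2 * Real.cos (m * t)) (f (Real.cos t)) := by
  have : Fact (0 < 2 * π) := ⟨Real.two_pi_pos⟩
  have hcont : Continuous fun x : AddCircle (2 * π) => ((f (Real.Angle.cos x) : ℝ) : ℂ) :=
    Complex.continuous_ofReal.comp (hf.comp_continuous Real.Angle.continuous_cos fun x => by
      induction x using Real.Angle.induction_on with
      | h x => exact ⟨Real.neg_one_le_cos x, Real.cos_le_one x⟩)
  let F : C(AddCircle (2 * π), ℂ) := ⟨_, hcont⟩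
  have hF : ∀ x : ℝ, F (x : AddCircle (2 * π)) = ((f (Real.cos x) : ℝ) : ℂ) := fun x => rfl
  have hcoeff : ∀ n : ℤ, fourierCoeff F n = ((chebCoeff f n.natAbs / 2 : ℝ) : ℂ) := by
    intro n
    rw [fourierCoeff_eq_intervalIntegral F n (-π), show -π + 2 * π = π by ring]
    have : ∀ x : ℝ, fourier (-n) (x : AddCircle (2 * π)) • F (x : AddCircle (2 * π)) =
        Complex.exp (-(Complex.I * n * x)) * (f (Real.cos x) : ℂ) := by
      intro x
      rw [hF, fourier_coe_apply, smul_eq_mul]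
      congr 2
      have : (π : ℂ) ≠ 0 := by exact_mod_cast Real.pi_ne_zero
      push_cast
      field_simp
    simp_rw [this]
    rw [integral_exp_mul_comp_cos hf, Complex.real_smul, ← Complex.ofReal_mul]
    congr 1
    field_simp
  have hsum : Summable fun m : ℤ => chebCoeff f m.natAbs / 2 := by
    apply Summable.of_nat_of_neg <;> simpa using hs.div_const 2
  have hsumF : Summable (fourierCoeff F) := by
    rw [funext hcoeff]
    exact Complex.summable_ofReal.2 hsum
  have := Complex.hasSum_re (has_pointwise_sum_fourier_series_of_summable hsumF
    (t : AddCircle (2 * π)))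
  rw [hF, Complex.ofReal_re] at this
  convert this using 2 with m
  rw [hcoeff, fourier_coe_apply, smul_eq_mul, Complex.re_ofReal_mul]
  congr 1
  have hpi : (π : ℂ) ≠ 0 := by exact_mod_cast Real.pi_ne_zero
  have : 2 * (π : ℂ) * Complex.I * m * t / ((2 * π : ℝ) : ℂ) = ((m * t : ℝ) : ℂ) * Complex.I := by
    push_cast
    field_simp
  rw [this, Complex.exp_ofReal_mul_I_re]

lemma integral_cos_two_mul_nat_mul_sin (k : ℕ) :
    ∫ t in (0 : ℝ)..π, Real.cos ((2 * k : ℕ) * t) * Real.sin t = 2 / (1 - 4 * (k : ℝ) ^ 2) := by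
  have h1 : (2 * (k : ℝ) + 1) ≠ 0 := by positivity
  have h2 : (2 * (k : ℝ) - 1) ≠ 0 := by
    intro h
    have : 2 * (k : ℤ) - 1 = 0 := by exact_mod_cast h
    omega
  have hd : ∀ t ∈ Set.uIcc (0 : ℝ) π, HasDerivAt
      (fun t : ℝ => -(Real.cos ((2 * k + 1) * t) / (2 * k + 1)) / 2
        + Real.cos ((2 * k - 1) * t) / (2 * k - 1) / 2)
      (Real.cos ((2 * k : ℕ) * t) * Real.sin t) t := by
    intro t _
    have d1 : HasDerivAt (fun t : ℝ => Real.cos ((2 * k + 1) * t))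
        (-Real.sin ((2 * k + 1) * t) * ((2 * k + 1) * 1)) t :=
      ((hasDerivAt_id t).const_mul (2 * (k : ℝ) + 1)).cos
    have d2 : HasDerivAt (fun t : ℝ => Real.cos ((2 * k - 1) * t))
        (-Real.sin ((2 * k - 1) * t) * ((2 * k - 1) * 1)) t :=
      ((hasDerivAt_id t).const_mul (2 * (k : ℝ) - 1)).cos
    refine ((((d1.div_const (2 * (k : ℝ) + 1)).neg).div_const 2).add
      ((d2.div_const (2 * (k : ℝ) - 1)).div_const 2)).congr_deriv ?_
    rw [show (2 * (k : ℝ) + 1) * t = (2 * k * t) + t by ring,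
      show (2 * (k : ℝ) - 1) * t = (2 * k * t) - t by ring, Real.sin_add, Real.sin_sub]
    push_cast
    field_simp
    ring
  rw [intervalIntegral.integral_eq_sub_of_hasDerivAt hd
    (Continuous.intervalIntegrable (by fun_prop) _ _)]
  have e1 : Real.cos ((2 * k + 1) * π) = -1 := by
    rw [show (2 * (k : ℝ) + 1) * π = k * (2 * π) + π by ring, Real.cos_nat_mul_two_pi_add_pi]
  have e2 : Real.cos ((2 * k - 1) * π) = -1 := by
    rw [show (2 * (k : ℝ) - 1) * π = k * (2 * π) - π by ring, Real.cos_nat_mul_two_pi_sub_pi]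
  rw [e1, e2]
  simp only [mul_zero, Real.cos_zero]
  rw [show 1 - 4 * (k : ℝ) ^ 2 = -((2 * k + 1) * (2 * k - 1)) by ring]
  field_simp
  ring

lemma integral_cos_odd_mul_sin (n : ℕ) (hn : Odd n) :
    ∫ t in (0 : ℝ)..π, Real.cos (n * t) * Real.sin t = 0 := by
  have h := intervalIntegral.integral_comp_sub_left (a := 0) (b := π)
    (fun t : ℝ => Real.cos (n * t) * Real.sin t) π
  have h2 : ∀ t : ℝ, Real.cos (n * (π - t)) * Real.sin (π - t)
      = -(Real.cos (n * t) * Real.sin t) := by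
    intro t
    rw [mul_sub, Real.cos_nat_mul_pi_sub, Real.sin_pi_sub, hn.neg_one_pow]
    ring
  simp_rw [h2] at h
  rw [intervalIntegral.integral_neg, sub_self, sub_zero] at h
  linarith

lemma integral_eq_integral_comp_cos_mul_sin {f : ℝ → ℝ}
    (hf : ContinuousOn f (Set.Icc (-1) 1)) :
    ∫ x in (-1 : ℝ)..1, f x = ∫ t in (0 : ℝ)..π, f (Real.cos t) * Real.sin t := by
  have h := intervalIntegral.integral_comp_mul_deriv'' (a := 0) (b := π) (f := Real.cos)
    (f' := fun t => -Real.sin t) (g := f) Real.continuous_cos.continuousOn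
    (fun t _ => (Real.hasDerivAt_cos t).hasDerivWithinAt)
    Real.continuous_sin.neg.continuousOn
    (hf.mono (by rintro _ ⟨t, _, rfl⟩; exact ⟨Real.neg_one_le_cos t, Real.cos_le_one t⟩))
  rw [Real.cos_zero, Real.cos_pi, intervalIntegral.integral_symm (-1) 1] at h
  simp only [Function.comp_apply, mul_neg, intervalIntegral.integral_neg, neg_inj] at h
  exact h.symm

/-- Termwise integration of the Chebyshev series. -/
lemma hasSum_chebCoeff_integral {f : ℝ → ℝ} (hf : ContinuousOn f (Set.Icc (-1) 1))
    (hs : Summable (chebCoeff f)) :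
    HasSum (fun k : ℕ => chebCoeff f (2 * k) * (2 / (1 - 4 * (k : ℝ) ^ 2)))
      ((∫ x in (-1 : ℝ)..1, f x) + chebCoeff f 0) := by
  have hsum : Summable fun m : ℤ => |chebCoeff f m.natAbs| / 2 := by
    apply Summable.of_nat_of_neg <;> simpa using hs.abs.div_const 2
  have h := intervalIntegral.hasSum_integral_of_dominated_convergence
    (μ := MeasureTheory.volume) (a := 0) (b := π)
    (F := fun (m : ℤ) t => chebCoeff f m.natAbs / 2 * Real.cos (m * t) * Real.sin t)
    (f := fun t => f (Real.cos t) * Real.sin t)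
    (fun m _ => |chebCoeff f m.natAbs| / 2)
    (fun m => Continuous.aestronglyMeasurable (by fun_prop))
    (fun m => Eventually.of_forall fun t _ => by
      rw [norm_mul, norm_mul, norm_div, Real.norm_eq_abs, Real.norm_eq_abs, Real.norm_eq_abs,
        Real.norm_eq_abs, abs_of_pos (zero_lt_two' ℝ), mul_assoc]
      refine mul_le_of_le_one_right (by positivity) ?_
      exact mul_le_one₀ (Real.abs_cos_le_one _) (abs_nonneg _) (Real.abs_sin_le_one _))
    (Eventually.of_forall fun t _ => hsum)
    intervalIntegrable_const
    (Eventually.of_forall fun t _ => (hasSum_chebCoeff_mul_cos hf hs t).mul_right _)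
  rw [← integral_eq_integral_comp_cos_mul_sin hf] at h
  simp_rw [mul_assoc, intervalIntegral.integral_const_mul] at h
  have h := h.nat_add_neg
  have key : ∀ n : ℕ, chebCoeff f (n : ℤ).natAbs / 2 *
        (∫ t in (0 : ℝ)..π, Real.cos ((n : ℤ) * t) * Real.sin t) +
      chebCoeff f (-(n : ℤ)).natAbs / 2 *
        (∫ t in (0 : ℝ)..π, Real.cos ((-(n : ℤ) : ℤ) * t) * Real.sin t) =
      chebCoeff f n * ∫ t in (0 : ℝ)..π, Real.cos (n * t) * Real.sin t := by
    intro n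
    simp only [Int.natAbs_neg, Int.natAbs_natCast, Int.cast_neg, Int.cast_natCast, neg_mul,
      Real.cos_neg]
    ring
  simp_rw [key] at h
  have h0 : chebCoeff f (0 : ℤ).natAbs / 2 *
      (∫ t in (0 : ℝ)..π, Real.cos ((0 : ℤ) * t) * Real.sin t) = chebCoeff f 0 := by
    simp
    norm_num
  rw [h0, ← (mul_right_injective₀ (two_ne_zero' ℕ)).hasSum_iff] at h
  · simpa only [Function.comp_def, integral_cos_two_mul_nat_mul_sin] using h
  · intro n hn
    rw [integral_cos_odd_mul_sin n, mul_zero]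
    rw [← Nat.not_even_iff_odd]
    rintro ⟨k, rfl⟩
    exact hn ⟨k, by ring⟩

lemma ccDelta_eq {n : ℕ} (hn : n ≠ 0) (j : ℕ) :
    ccDelta n j = 1 - (if j = 0 then 1 / 2 else 0) - (if j = n then 1 / 2 else 0) := by
  unfold ccDelta
  grind

lemma sum_ccDelta_mul {n : ℕ} (hn : n ≠ 0) (h : ℕ → ℝ) :
    ∑ j ∈ range (n + 1), ccDelta n j * h j = ∑ j ∈ range n, (h j + h (j + 1)) / 2 := by
  simp_rw [ccDelta_eq hn, sub_mul, one_mul, sum_sub_distrib, ite_mul, zero_mul,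
    sum_ite_eq', mem_range, ← sum_div, sum_add_distrib]
  rw [if_pos (by omega), if_pos (by omega)]
  have h1 := sum_range_succ h n
  have h2 := sum_range_succ' h n
  linarith

/-- Orthogonality of cosines under the trapezoidal rule. -/
lemma sum_ccDelta_mul_cos {n : ℕ} (hn : n ≠ 0) (r : ℤ) :
    ∑ j ∈ range (n + 1), ccDelta n j * Real.cos (r * (j * π / n)) =
      if (2 * n : ℤ) ∣ r then (n : ℝ) else 0 := by
  have hn' : (n : ℝ) ≠ 0 := by exact_mod_cast hn
  split_ifs with hr
  · obtain ⟨q, rfl⟩ := hr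
    have h1 : ∀ j : ℕ, Real.cos (((2 * n * q : ℤ) : ℝ) * (j * π / n)) = 1 := by
      intro j
      rw [show ((2 * n * q : ℤ) : ℝ) * (j * π / n) = ((q * j : ℤ) : ℝ) * (2 * π) by
        push_cast
        field_simp]
      exact Real.cos_int_mul_two_pi _
    simp_rw [h1]
    rw [sum_ccDelta_mul hn fun _ => 1]
    simp
  · rw [sum_ccDelta_mul hn fun j => Real.cos (r * (j * π / n))]
    set x : ℝ := r * π / (2 * n) with hx
    have hsin : Real.sin x ≠ 0 := by
      rw [Ne, Real.sin_eq_zero_iff]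
      rintro ⟨q, hq⟩
      apply hr
      refine ⟨q, ?_⟩
      rw [hx] at hq
      have hpi := Real.pi_ne_zero
      field_simp at hq
      have : (r : ℝ) = 2 * n * q := by linarith
      exact_mod_cast this
    have key : ∀ N : ℕ, Real.sin x *
        ∑ j ∈ range N, (Real.cos (r * (j * π / n)) + Real.cos (r * ((j + 1 : ℕ) * π / n))) / 2 =
        Real.sin (N * (2 * x)) * Real.cos x / 2 := by
      intro N
      induction N with
      | zero => simp
      | succ N ih =>
        rw [sum_range_succ, mul_add, ih]
        have e1 : (r : ℝ) * (N * π / n) = N * (2 * x) := by rw [hx]; field_simp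
        have e2 : (r : ℝ) * ((N + 1 : ℕ) * π / n) = N * (2 * x) + 2 * x := by
          rw [hx]; push_cast; field_simp
        have e3 : ((N + 1 : ℕ) : ℝ) * (2 * x) = N * (2 * x) + 2 * x := by push_cast; ring
        rw [e1, e2, e3, Real.sin_add, Real.cos_add, Real.sin_two_mul, Real.cos_two_mul]
        have := Real.sin_sq_add_cos_sq x
        linear_combination (-Real.sin (N * (2 * x)) * Real.cos x) * this
    have h := key n
    rw [show (n : ℝ) * (2 * x) = r * π by rw [hx]; field_simp, Real.sin_int_mul_pi,
      zero_mul, zero_div] at h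
    exact (mul_eq_zero.1 h).resolve_left hsin

/-- The trapezoidal approximation of the `l`-th Chebyshev coefficient. -/
noncomputable def discreteChebCoeff (f : ℝ → ℝ) (n l : ℕ) : ℝ :=
  (2 / n) * ∑ j ∈ range (n + 1), ccDelta n j *
    (f (Real.cos (j * π / n)) * Real.cos (l * (j * π / n)))

lemma ccQuad_eq_sum_discreteChebCoeff (f : ℝ → ℝ) (n : ℕ) :
    ccQuad f n = ∑ k ∈ range (n / 2 + 1),
      ccDelta n (2 * k) * (2 / (1 - 4 * (k : ℝ) ^ 2) * discreteChebCoeff f n (2 * k)) := by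
  unfold ccQuad ccWeight discreteChebCoeff
  simp_rw [mul_sum, sum_mul]
  rw [sum_comm]
  refine sum_congr rfl fun k _ => sum_congr rfl fun j _ => ?_
  rw [show 2 * (j : ℝ) * k * π / n = ((2 * k : ℕ) : ℝ) * (j * π / n) by push_cast; ring]
  ring

/-- Aliasing: discrete Chebyshev coefficients in terms of exact ones. -/
lemma hasSum_discreteChebCoeff_sub {f : ℝ → ℝ} (hf : ContinuousOn f (Set.Icc (-1) 1))
    (hs : Summable (chebCoeff f)) {n l : ℕ} (hn : n ≠ 0) (hl : l ≤ n) :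
    HasSum (fun p : ℕ => chebCoeff f (2 * n * (p + 1) + l) + chebCoeff f (2 * n * (p + 1) - l))
      (discreteChebCoeff f n l - chebCoeff f l) := by
  have hn' : (n : ℝ) ≠ 0 := by exact_mod_cast hn
  have hnz : (2 * n : ℤ) ≠ 0 := by exact_mod_cast mul_ne_zero two_ne_zero hn
  set a : ℤ → ℝ := fun m => chebCoeff f m.natAbs with ha
  have ha_neg : ∀ m, a (-m) = a m := fun m => by simp [ha]
  have hsum : Summable a := by
    apply Summable.of_nat_of_neg <;> simpa [ha] using hs
  have h1 : HasSum (fun m : ℤ => (2 / n) * ∑ j ∈ range (n + 1), ccDelta n j *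
      (a m / 2 * Real.cos (m * (j * π / n)) * Real.cos (l * (j * π / n))))
      (discreteChebCoeff f n l) :=
    (hasSum_sum fun j _ => ((hasSum_chebCoeff_mul_cos hf hs _).mul_right _).mul_left _).mul_left _
  have h2 : ∀ m : ℤ, (2 / n) * ∑ j ∈ range (n + 1), ccDelta n j *
      (a m / 2 * Real.cos (m * (j * π / n)) * Real.cos (l * (j * π / n))) =
      ((if (2 * n : ℤ) ∣ m - l then a m else 0) + if (2 * n : ℤ) ∣ m + l then a m else 0) / 2 := by
    intro m
    have h3 : ∀ j : ℕ, ccDelta n j *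
        (a m / 2 * Real.cos (m * (j * π / n)) * Real.cos (l * (j * π / n))) =
        a m / 4 * (ccDelta n j * Real.cos ((m - l : ℤ) * (j * π / n)) +
          ccDelta n j * Real.cos ((m + l : ℤ) * (j * π / n))) := by
      intro j
      push_cast
      rw [sub_mul, add_mul, Real.cos_sub, Real.cos_add]
      ring
    simp_rw [h3]
    rw [← mul_sum, sum_add_distrib, sum_ccDelta_mul_cos hn, sum_ccDelta_mul_cos hn]
    split_ifs <;> field_simp <;> ring
  simp_rw [h2] at h1
  have hinj : Function.Injective fun p : ℤ => 2 * (n : ℤ) * p + l := by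
    intro p q hpq
    exact mul_left_cancel₀ hnz (add_right_cancel hpq)
  have h4 : HasSum (fun p : ℤ => a (2 * n * p + l)) (∑' p : ℤ, a (2 * n * p + l)) :=
    (hsum.comp_injective hinj).hasSum
  set S := ∑' p : ℤ, a (2 * n * p + l) with hS
  have h5 : HasSum (fun m : ℤ => if (2 * n : ℤ) ∣ m - l then a m else 0) S := by
    rw [← hinj.hasSum_iff]
    · simpa [Function.comp_def] using h4
    · intro m hm
      rw [if_neg]
      rintro ⟨q, hq⟩
      exact hm ⟨q, by simp only; linarith⟩
  have h6 : HasSum (fun m : ℤ => if (2 * n : ℤ) ∣ m + l then a m else 0) S := by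
    rw [← (Equiv.neg ℤ).hasSum_iff]
    convert h5 using 2 with m
    simp only [Function.comp_apply, Equiv.neg_apply, ha_neg]
    congr 1
    rw [show -m + (l : ℤ) = -(m - l) by ring, dvd_neg]
  have h7 : S = discreteChebCoeff f n l := by
    have := ((h5.add h6).div_const 2).unique h1
    linarith
  rw [h7] at h4
  have h8 := (hasSum_nat_add_iff' 1).2 h4.nat_add_neg
  have e1 : ∀ p : ℕ, a (2 * n * ((p + 1 : ℕ) : ℤ) + l) + a (2 * n * -((p + 1 : ℕ) : ℤ) + l) =
      chebCoeff f (2 * n * (p + 1) + l) + chebCoeff f (2 * n * (p + 1) - l) := by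
    intro p
    have hle : l ≤ 2 * n * (p + 1) := by nlinarith
    have i1 : 2 * (n : ℤ) * ((p + 1 : ℕ) : ℤ) + l = ((2 * n * (p + 1) + l : ℕ) : ℤ) := by
      push_cast; ring
    have i2 : 2 * (n : ℤ) * -((p + 1 : ℕ) : ℤ) + l = -((2 * n * (p + 1) - l : ℕ) : ℤ) := by
      push_cast [hle]; ring
    rw [i1, i2, ha_neg]
    simp only [ha, Int.natAbs_natCast]
  simp_rw [e1] at h8
  have e2 : ∀ x : ℝ, x + a (2 * n * 0 + l) - ∑ i ∈ range 1,
      (a (2 * n * (i : ℤ) + l) + a (2 * n * -(i : ℤ) + l)) = x - chebCoeff f l := by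
    intro x
    simp only [range_one, sum_singleton, Nat.cast_zero, neg_zero, mul_zero, zero_add, ha,
      Int.natAbs_natCast]
    ring
  rwa [e2] at h8

lemma one_sub_four_mul_sq_neg {k : ℕ} (hk : k ≠ 0) : 1 - 4 * (k : ℝ) ^ 2 < 0 := by
  have : (1 : ℝ) ≤ k := by exact_mod_cast Nat.one_le_iff_ne_zero.2 hk
  nlinarith

/-- The integral of the Chebyshev polynomial of degree `2 * k` over `[-1, 1]`. -/
noncomputable def chebMoment (k : ℕ) : ℝ := 2 / (1 - 4 * (k : ℝ) ^ 2)

lemma chebMoment_zero : chebMoment 0 = 2 := by simp [chebMoment]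

lemma chebMoment_succ (k : ℕ) :
    chebMoment (k + 1) = 1 / (2 * (k + 1 : ℕ) + 1) - 1 / (2 * (k : ℝ) + 1) := by
  have h := (one_sub_four_mul_sq_neg k.succ_ne_zero).ne
  have h1 : (2 * (k : ℝ) + 1) ≠ 0 := by positivity
  have h2 : (2 * ((k : ℝ) + 1) + 1) ≠ 0 := by positivity
  rw [chebMoment]
  push_cast at *
  rw [div_sub_div _ _ h2 h1, div_eq_div_iff h (mul_ne_zero h2 h1)]
  ring

lemma abs_chebMoment_succ (k : ℕ) :
    |chebMoment (k + 1)| = 1 / (2 * (k : ℝ) + 1) - 1 / (2 * (k + 1 : ℕ) + 1) := by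
  have h : chebMoment (k + 1) < 0 :=
    div_neg_of_pos_of_neg two_pos (one_sub_four_mul_sq_neg k.succ_ne_zero)
  rw [abs_of_neg h, chebMoment_succ]
  ring

lemma sum_chebMoment (N : ℕ) :
    ∑ k ∈ range (N + 1), chebMoment k = 1 + 1 / (2 * (N : ℝ) + 1) := by
  induction N with
  | zero => simp [chebMoment_zero]; norm_num
  | succ N ih => rw [sum_range_succ, ih, chebMoment_succ]; ring

lemma sum_abs_chebMoment_add (N M : ℕ) :
    ∑ k ∈ range M, |chebMoment (k + (N + 1))| =
      1 / (2 * (N : ℝ) + 1) - 1 / (2 * (N + M : ℕ) + 1) := by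
  induction M with
  | zero => simp
  | succ M ih =>
    rw [sum_range_succ, ih, ← add_assoc M N 1, abs_chebMoment_succ, add_comm M N, add_assoc N M 1]
    push_cast
    ring

lemma sum_abs_chebMoment_le (N : ℕ) : ∑ k ∈ range (N + 1), |chebMoment k| ≤ 3 := by
  rw [sum_range_succ', chebMoment_zero, abs_two]
  have h := sum_abs_chebMoment_add 0 N
  simp only [zero_add, Nat.cast_zero, mul_zero, div_one] at h
  rw [h]
  have : 0 ≤ 1 / (2 * (N : ℝ) + 1) := by positivity
  linarith

lemma abs_chebMoment_mul_sq_le (k : ℕ) : |chebMoment k| * (k : ℝ) ^ 2 ≤ 1 := by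
  rcases eq_or_ne k 0 with rfl | hk
  · simp
  have h := one_sub_four_mul_sq_neg hk
  have h1 : (1 : ℝ) ≤ k := by exact_mod_cast Nat.one_le_iff_ne_zero.2 hk
  rw [chebMoment, abs_div, abs_two, abs_of_neg h, div_mul_eq_mul_div, div_le_one (by linarith)]
  nlinarith

lemma abs_hasSum_mul_chebMoment_le {b : ℕ → ℝ} {N : ℕ} {S B : ℝ} (hb : ∀ k, |b k| ≤ B)
    (h : HasSum (fun k => b k * chebMoment (k + (N + 1))) S) :
    |S| ≤ B * (1 / (2 * (N : ℝ) + 1)) := by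
  refine le_of_tendsto h.tendsto_sum_nat.abs (Eventually.of_forall fun M => ?_)
  have hB : 0 ≤ B := (abs_nonneg _).trans (hb 0)
  calc |∑ k ∈ range M, b k * chebMoment (k + (N + 1))|
      ≤ ∑ k ∈ range M, B * |chebMoment (k + (N + 1))| := by
        refine (abs_sum_le_sum_abs _ _).trans (sum_le_sum fun k _ => ?_)
        rw [abs_mul]
        exact mul_le_mul_of_nonneg_right (hb k) (abs_nonneg _)
    _ ≤ _ := by
        rw [← mul_sum, sum_abs_chebMoment_add]
        refine mul_le_mul_of_nonneg_left ?_ hB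
        have : 0 ≤ 1 / (2 * ((N + M : ℕ) : ℝ) + 1) := by positivity
        linarith

lemma sum_ccDelta_two_mul {n : ℕ} (hn : n ≠ 0) (g : ℕ → ℝ) :
    ∑ k ∈ range (n / 2 + 1), ccDelta n (2 * k) * g k =
      ∑ k ∈ range (n / 2 + 1), g k - g 0 / 2 - if Even n then g (n / 2) / 2 else 0 := by
  have h1 : ∀ k, (2 * k = 0) = (k = 0) := fun k => by simp
  have h2 : ∀ k, (2 * k = n) = (Even n ∧ k = n / 2) := fun k => by grind
  simp_rw [ccDelta_eq hn, sub_mul, one_mul, sum_sub_distrib, ite_mul, zero_mul, h1, h2, ite_and]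
  rw [sum_ite_eq', if_pos (by simp)]
  split_ifs
  · rw [sum_ite_eq', if_pos (by simp)]
    ring
  · simp
    ring

lemma abs_ccDelta_le_one (n j : ℕ) : |ccDelta n j| ≤ 1 := by
  unfold ccDelta
  split_ifs <;> norm_num [abs_le]

lemma abs_chebMoment_half_le {n : ℕ} (hn : 2 ≤ n) (he : Even n) :
    |chebMoment (n / 2) / 2| ≤ 1 / n := by
  obtain ⟨k, rfl⟩ := he
  have hk : k ≠ 0 := by omega
  have h := one_sub_four_mul_sq_neg hk
  have h1 : (1 : ℝ) ≤ k := by exact_mod_cast Nat.one_le_iff_ne_zero.2 hk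
  rw [show (k + k) / 2 = k by omega, chebMoment, abs_div, abs_div, abs_two, abs_of_neg h]
  push_cast
  rw [div_right_comm, div_self two_ne_zero]
  apply one_div_le_one_div_of_le <;> nlinarith

lemma one_div_two_mul_half_add_one_le {n : ℕ} (hn : n ≠ 0) :
    1 / (2 * ((n / 2 : ℕ) : ℝ) + 1) ≤ 1 / n := by
  apply one_div_le_one_div_of_le
  · exact_mod_cast Nat.pos_of_ne_zero hn
  · have : n ≤ 2 * (n / 2) + 1 := by omega
    exact_mod_cast this

lemma abs_sum_ccDelta_mul_chebMoment_le {n : ℕ} (hn : 2 ≤ n) :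
    |∑ k ∈ range (n / 2 + 1), ccDelta n (2 * k) * chebMoment k| ≤ 2 / n := by
  have hn0 : n ≠ 0 := by omega
  rw [sum_ccDelta_two_mul hn0, sum_chebMoment, chebMoment_zero]
  have h1 := one_div_two_mul_half_add_one_le hn0
  have h2 : 0 ≤ 1 / (2 * ((n / 2 : ℕ) : ℝ) + 1) := by positivity
  have h3 : (2 : ℝ) / n = 1 / n + 1 / n := by ring
  split_ifs with he
  · have h4 := abs_le.1 (abs_chebMoment_half_le hn he)
    rw [h3, abs_le]
    constructor <;> linarith [h4.1, h4.2]
  · rw [h3, abs_le]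
    constructor <;> linarith

/-- The Clenshaw–Curtis error splits into a tail and an aliasing part. -/
lemma ccError_eq (f : ℝ → ℝ) {n : ℕ} (hn : n ≠ 0) :
    ccError f n = (∫ x in (-1 : ℝ)..1, f x) + chebCoeff f 0 -
        ∑ k ∈ range (n / 2 + 1), chebCoeff f (2 * k) * chebMoment k +
        (if Even n then chebCoeff f n * (chebMoment (n / 2) / 2) else 0) -
        ∑ k ∈ range (n / 2 + 1), ccDelta n (2 * k) *
          (chebMoment k * (discreteChebCoeff f n (2 * k) - chebCoeff f (2 * k))) := by
  have h := sum_ccDelta_two_mul hn fun k => chebCoeff f (2 * k) * chebMoment k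
  have h2 : (if Even n then chebCoeff f (2 * (n / 2)) * chebMoment (n / 2) / 2 else 0) =
      if Even n then chebCoeff f n * (chebMoment (n / 2) / 2) else 0 := by
    split_ifs with he
    · rw [Nat.two_mul_div_two_of_even he]
      ring
    · rfl
  simp only [h2, mul_zero, chebMoment_zero] at h
  have h3 : ∑ k ∈ range (n / 2 + 1), ccDelta n (2 * k) *
      (chebMoment k * (discreteChebCoeff f n (2 * k) - chebCoeff f (2 * k))) =
      ccQuad f n - ∑ k ∈ range (n / 2 + 1), ccDelta n (2 * k) *
        (chebCoeff f (2 * k) * chebMoment k) := by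
    rw [ccQuad_eq_sum_discreteChebCoeff, ← sum_sub_distrib]
    refine sum_congr rfl fun k _ => ?_
    rw [chebMoment]
    ring
  rw [h3, h, ccError]
  ring

lemma exists_abs_one_sub_rpow_add_le (q : ℝ) :
    ∃ C : ℝ, 0 ≤ C ∧ ∀ u ∈ Set.Icc (0 : ℝ) (1 / 2),
      |(1 - u) ^ (-q) + (1 + u) ^ (-q) - 2| ≤ C * u ^ 2 := by
  set g : ℝ → ℝ := fun u => (1 - u) ^ (-q) + (1 + u) ^ (-q) - 2 with hg
  have hcd : ContDiffOn ℝ ((1 : ℕ) + 1) g (Set.Icc 0 (1 / 2)) := by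
    have h1 : ContDiffOn ℝ ((1 : ℕ) + 1) (fun u : ℝ => (1 - u) ^ (-q)) (Set.Icc 0 (1 / 2)) :=
      (contDiffOn_const.sub contDiffOn_id).rpow_const_of_ne fun u hu => by
        have := hu.2
        simp only [id]
        linarith
    have h2 : ContDiffOn ℝ ((1 : ℕ) + 1) (fun u : ℝ => (1 + u) ^ (-q)) (Set.Icc 0 (1 / 2)) :=
      (contDiffOn_const.add contDiffOn_id).rpow_const_of_ne fun u hu => by
        have := hu.1
        simp only [id]
        linarith
    exact (h1.add h2).sub contDiffOn_const
  have hder : HasDerivAt g 0 0 := by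
    have h1 : HasDerivAt (fun u : ℝ => (1 - u) ^ (-q)) (-1 * -q * (1 - 0) ^ (-q - 1)) 0 :=
      ((hasDerivAt_id (0 : ℝ)).const_sub 1).rpow_const (Or.inl (by simp))
    have h2 : HasDerivAt (fun u : ℝ => (1 + u) ^ (-q)) (1 * -q * (1 + 0) ^ (-q - 1)) 0 :=
      ((hasDerivAt_id (0 : ℝ)).const_add 1).rpow_const (Or.inl (by simp))
    exact ((h1.add h2).sub_const 2).congr_deriv (by simp)
  obtain ⟨C, hC⟩ := exists_taylor_mean_remainder_bound (by norm_num) hcd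
  have hdw : derivWithin g (Set.Icc 0 (1 / 2)) 0 = 0 :=
    hder.hasDerivWithinAt.derivWithin (uniqueDiffOn_Icc (by norm_num) 0 (by norm_num))
  refine ⟨|C|, abs_nonneg C, fun u hu => ?_⟩
  have h := hC u hu
  have h0 : g 0 = 0 := by simp [hg]; norm_num
  rw [taylorWithinEval_succ, taylor_within_zero_eval, iteratedDerivWithin_one, hdw, h0] at h
  simp only [smul_zero, add_zero, sub_zero, Real.norm_eq_abs] at h
  exact h.trans (mul_le_mul_of_nonneg_right (le_abs_self C) (sq_nonneg u))

/-- Second-order symmetric difference estimate for a negative power. -/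
lemma exists_abs_sub_rpow_add_le (q : ℝ) :
    ∃ C : ℝ, 0 ≤ C ∧ ∀ x y : ℝ, 0 < x → 0 ≤ y → 2 * y ≤ x →
      |(x - y) ^ (-q) + (x + y) ^ (-q) - 2 * x ^ (-q)| ≤ C * (y / x) ^ 2 * x ^ (-q) := by
  obtain ⟨C, hC0, hC⟩ := exists_abs_one_sub_rpow_add_le q
  refine ⟨C, hC0, fun x y hx hy hxy => ?_⟩
  have hu0 : 0 ≤ y / x := by positivity
  have hu1 : y / x ≤ 1 / 2 := by rw [div_le_div_iff₀ hx two_pos]; linarith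
  have h := hC (y / x) ⟨hu0, hu1⟩
  have e1 : x - y = x * (1 - y / x) := by field_simp
  have e2 : x + y = x * (1 + y / x) := by field_simp
  have hxq : 0 ≤ x ^ (-q) := by positivity
  rw [e1, e2, Real.mul_rpow hx.le (by linarith), Real.mul_rpow hx.le (by linarith)]
  calc |x ^ (-q) * (1 - y / x) ^ (-q) + x ^ (-q) * (1 + y / x) ^ (-q) - 2 * x ^ (-q)|
      = |(1 - y / x) ^ (-q) + (1 + y / x) ^ (-q) - 2| * x ^ (-q) := by
        rw [← abs_of_nonneg hxq, ← abs_mul, abs_of_nonneg hxq]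
        congr 1
        ring
    _ ≤ _ := mul_le_mul_of_nonneg_right h hxq

lemma exists_abs_add_sub_le {a : ℕ → ℝ} {q c C₀ : ℝ} {M : ℕ} (hq : 0 ≤ q) (hC₀ : 0 ≤ C₀)
    (ha : ∀ m : ℕ, M ≤ m → Even m → |a m - c * (m : ℝ) ^ (-q)| ≤ C₀ * ((m : ℝ) ^ (-q) / m)) :
    ∃ C : ℝ, 0 ≤ C ∧ ∀ n k p : ℕ, n ≠ 0 → M ≤ n → 2 * k ≤ n →
      |a (2 * n * (p + 1) + 2 * k) + a (2 * n * (p + 1) - 2 * k) -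
          2 * c * (2 * n : ℝ) ^ (-q) * ((p + 1 : ℕ) : ℝ) ^ (-q)| ≤
        (2 * C₀ + C * ((k : ℝ) ^ 2 / n)) * ((n : ℝ) ^ (-q) / n) * ((p + 1 : ℕ) : ℝ) ^ (-q) := by
  obtain ⟨C, hC0, hC⟩ := exists_abs_sub_rpow_add_le q
  refine ⟨|c| * C, by positivity, fun n k p hn hM hk => ?_⟩
  have hn1 : (1 : ℝ) ≤ n := by exact_mod_cast Nat.one_le_iff_ne_zero.2 hn
  have hn0 : (0 : ℝ) < n := by linarith
  set P : ℝ := ((p + 1 : ℕ) : ℝ) with hP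
  have hP1 : (1 : ℝ) ≤ P := by rw [hP]; exact_mod_cast p.succ_pos
  have hP0 : 0 < P := by linarith
  have hk' : 2 * (k : ℝ) ≤ n := by exact_mod_cast hk
  have hnP : (n : ℝ) ≤ n * P := le_mul_of_one_le_right hn0.le hP1
  have hle : 2 * k ≤ 2 * n * (p + 1) := by nlinarith
  have hx : 0 < 2 * (n : ℝ) * P := by positivity
  set D : ℝ := (n : ℝ) ^ (-q) * P ^ (-q) with hD
  have hD0 : 0 ≤ D := by positivity
  have hpow : ∀ x : ℝ, n * P ≤ x → x ^ (-q) ≤ D := by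
    intro x hx
    rw [hD, ← Real.mul_rpow hn0.le hP0.le]
    exact Real.rpow_le_rpow_of_nonpos (by positivity) hx (neg_nonpos.2 hq)
  have hasym : ∀ m : ℕ, Even m → (n : ℝ) * P ≤ m →
      |a m - c * (m : ℝ) ^ (-q)| ≤ C₀ * (D / n) := by
    intro m hm hPm
    have hnm : (n : ℝ) ≤ m := hnP.trans hPm
    refine (ha m (hM.trans (by exact_mod_cast hnm)) hm).trans ?_
    exact mul_le_mul_of_nonneg_left (div_le_div₀ hD0 (hpow _ hPm) hn0 hnm) hC₀
  have c1 : ((2 * n * (p + 1) + 2 * k : ℕ) : ℝ) = 2 * n * P + 2 * k := by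
    rw [hP]; push_cast; ring
  have c2 : ((2 * n * (p + 1) - 2 * k : ℕ) : ℝ) = 2 * n * P - 2 * k := by
    rw [hP]; push_cast [hle]; ring
  have hk0 : (0 : ℝ) ≤ k := by positivity
  have b1 := hasym (2 * n * (p + 1) + 2 * k)
    (by rw [mul_assoc]; exact (even_two_mul _).add (even_two_mul _)) (by rw [c1]; nlinarith)
  have b2 := hasym (2 * n * (p + 1) - 2 * k)
    (by rw [mul_assoc, ← Nat.mul_sub]; exact even_two_mul _) (by rw [c2]; nlinarith)
  rw [c1] at b1
  rw [c2] at b2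
  have b3 := hC (2 * n * P) (2 * k) hx (by positivity) (by nlinarith)
  have b4 : C * (2 * k / (2 * n * P)) ^ 2 * (2 * n * P) ^ (-q) ≤
      C * ((k : ℝ) ^ 2 / n) * (D / n) := by
    have e1 : (2 * k / (2 * n * P)) ^ 2 ≤ (k / n : ℝ) ^ 2 := by
      apply pow_le_pow_left₀ (by positivity)
      rw [mul_assoc, mul_div_mul_left _ _ two_ne_zero]
      exact div_le_div_of_nonneg_left hk0 hn0 hnP
    calc C * (2 * k / (2 * n * P)) ^ 2 * (2 * n * P) ^ (-q)
        ≤ C * (k / n : ℝ) ^ 2 * D := by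
          refine mul_le_mul (mul_le_mul_of_nonneg_left e1 hC0) (hpow _ (by nlinarith))
            (by positivity) (by positivity)
      _ = _ := by field_simp
  have e2 : (2 * n * P : ℝ) ^ (-q) = (2 * n : ℝ) ^ (-q) * P ^ (-q) :=
    Real.mul_rpow (by positivity) hP0.le
  have b5 : |c * ((2 * n * P - 2 * k) ^ (-q) + (2 * n * P + 2 * k) ^ (-q)
      - 2 * (2 * n * P) ^ (-q))| ≤ |c| * (C * ((k : ℝ) ^ 2 / n) * (D / n)) := by
    rw [abs_mul]
    exact mul_le_mul_of_nonneg_left (b3.trans b4) (abs_nonneg c)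
  rw [e2] at b5
  have e3 : (2 * C₀ + |c| * C * ((k : ℝ) ^ 2 / n)) * ((n : ℝ) ^ (-q) / n) * P ^ (-q) =
      2 * (C₀ * (D / n)) + |c| * (C * ((k : ℝ) ^ 2 / n) * (D / n)) := by
    rw [hD]; ring
  rw [e3]
  rw [abs_le] at *
  constructor <;> linarith [b1.1, b1.2, b2.1, b2.2, b5.1, b5.2]

lemma summable_succ_rpow_neg {q : ℝ} (hq : 1 < q) :
    Summable fun p : ℕ => ((p + 1 : ℕ) : ℝ) ^ (-q) :=
  (summable_nat_add_iff (f := fun p : ℕ => (p : ℝ) ^ (-q)) 1).2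
    (Real.summable_nat_rpow.2 (by linarith))

lemma exists_abs_discreteChebCoeff_sub_le {f : ℝ → ℝ} (hf : ContinuousOn f (Set.Icc (-1) 1))
    (hs : Summable (chebCoeff f)) {q c C₀ : ℝ} {M : ℕ} (hq : 1 < q) (hC₀ : 0 ≤ C₀)
    (ha : ∀ m : ℕ, M ≤ m → Even m →
      |chebCoeff f m - c * (m : ℝ) ^ (-q)| ≤ C₀ * ((m : ℝ) ^ (-q) / m)) :
    ∃ C : ℝ, ∃ Z : ℝ, 0 ≤ C ∧ 0 ≤ Z ∧ ∀ n k : ℕ, n ≠ 0 → M ≤ n → 2 * k ≤ n →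
      |discreteChebCoeff f n (2 * k) - chebCoeff f (2 * k) - Z * (c * (2 * n : ℝ) ^ (-q))| ≤
        C * (1 + (k : ℝ) ^ 2 / n) * ((n : ℝ) ^ (-q) / n) := by
  obtain ⟨C, hC0, hC⟩ := exists_abs_add_sub_le (by linarith) hC₀ ha
  have hZ := (summable_succ_rpow_neg hq).hasSum
  set Z := ∑' p : ℕ, ((p + 1 : ℕ) : ℝ) ^ (-q) with hZdef
  have hZ0 : 0 ≤ Z := tsum_nonneg fun p => by positivity
  refine ⟨(2 * C₀ + C) * Z, 2 * Z, by positivity, by positivity, fun n k hn hM hk => ?_⟩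
  have h1 := (hasSum_discreteChebCoeff_sub hf hs hn hk).sub
    (hZ.mul_left (2 * c * (2 * n : ℝ) ^ (-q)))
  have h2 := tsum_of_norm_bounded
    (hZ.mul_left ((2 * C₀ + C * ((k : ℝ) ^ 2 / n)) * ((n : ℝ) ^ (-q) / n)))
    (fun p => (Real.norm_eq_abs _).trans_le (hC n k p hn hM hk))
  rw [h1.tsum_eq, Real.norm_eq_abs] at h2
  have e : 2 * Z * (c * (2 * n : ℝ) ^ (-q)) = 2 * c * (2 * n : ℝ) ^ (-q) * Z := by ring
  rw [e]
  refine h2.trans ?_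
  have h3 : 2 * C₀ + C * ((k : ℝ) ^ 2 / n) ≤ (2 * C₀ + C) * (1 + (k : ℝ) ^ 2 / n) := by
    have : 0 ≤ (k : ℝ) ^ 2 / n := by positivity
    nlinarith [mul_nonneg hC₀ this]
  calc _ ≤ (2 * C₀ + C) * (1 + (k : ℝ) ^ 2 / n) * ((n : ℝ) ^ (-q) / n) * Z := by gcongr
    _ = _ := by ring

lemma exists_abs_ccError_le {f : ℝ → ℝ} (hf : ContinuousOn f (Set.Icc (-1) 1))
    (hs : Summable (chebCoeff f)) {q c C₀ : ℝ} {M : ℕ} (hq : 1 < q) (hC₀ : 0 ≤ C₀)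
    (hb : ∀ m : ℕ, M ≤ m → |chebCoeff f m| ≤ C₀ * (m : ℝ) ^ (-q))
    (ha : ∀ m : ℕ, M ≤ m → Even m →
      |chebCoeff f m - c * (m : ℝ) ^ (-q)| ≤ C₀ * ((m : ℝ) ^ (-q) / m)) :
    ∃ K : ℝ, ∀ n : ℕ, 2 ≤ n → M ≤ n → |ccError f n| ≤ K * ((n : ℝ) ^ (-q) / n) := by
  obtain ⟨C, Z, hC0, hZ0, hC⟩ := exists_abs_discreteChebCoeff_sub_le hf hs hq hC₀ ha
  refine ⟨C₀ + C₀ + (2 * Z * |c| + 4 * C), fun n hn hM => ?_⟩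
  have hn0 : n ≠ 0 := by omega
  have hnpos : (0 : ℝ) < n := by exact_mod_cast Nat.pos_of_ne_zero hn0
  have hn2 : (2 : ℝ) ≤ n := by exact_mod_cast hn
  set Y : ℝ := (n : ℝ) ^ (-q) with hY
  have hY0 : 0 ≤ Y := by positivity
  have hpow : ∀ x : ℝ, (n : ℝ) ≤ x → x ^ (-q) ≤ Y := fun x hx =>
    Real.rpow_le_rpow_of_nonpos hnpos hx (by linarith)
  have h0 : HasSum (fun k => chebCoeff f (2 * k) * chebMoment k)
      ((∫ x in (-1 : ℝ)..1, f x) + chebCoeff f 0) := hasSum_chebCoeff_integral hf hs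
  have htail := (hasSum_nat_add_iff' (n / 2 + 1)).2 h0
  have b1 : |(∫ x in (-1 : ℝ)..1, f x) + chebCoeff f 0 -
      ∑ k ∈ range (n / 2 + 1), chebCoeff f (2 * k) * chebMoment k| ≤ C₀ * (Y / n) := by
    have hB : ∀ k : ℕ, |chebCoeff f (2 * (k + (n / 2 + 1)))| ≤ C₀ * Y := by
      intro k
      have hle : n ≤ 2 * (k + (n / 2 + 1)) := by omega
      refine (hb _ (hM.trans hle)).trans ?_
      exact mul_le_mul_of_nonneg_left (hpow _ (by exact_mod_cast hle)) hC₀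
    refine (abs_hasSum_mul_chebMoment_le hB htail).trans ?_
    calc _ ≤ C₀ * Y * (1 / n) := by
          gcongr ?_ * ?_
          exact one_div_two_mul_half_add_one_le hn0
      _ = _ := by ring
  have b2 : |if Even n then chebCoeff f n * (chebMoment (n / 2) / 2) else 0| ≤ C₀ * (Y / n) := by
    split_ifs with he
    · rw [abs_mul]
      calc _ ≤ C₀ * Y * (1 / n) :=
            mul_le_mul (hb n hM) (abs_chebMoment_half_le hn he) (abs_nonneg _) (by positivity)
        _ = _ := by ring
    · rw [abs_zero]
      positivity
  have b3 : |∑ k ∈ range (n / 2 + 1), ccDelta n (2 * k) *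
      (chebMoment k * (discreteChebCoeff f n (2 * k) - chebCoeff f (2 * k)))| ≤
      (2 * Z * |c| + 4 * C) * (Y / n) := by
    set R : ℕ → ℝ := fun k => discreteChebCoeff f n (2 * k) - chebCoeff f (2 * k)
      - Z * (c * (2 * n : ℝ) ^ (-q)) with hR
    have hsplit : ∑ k ∈ range (n / 2 + 1), ccDelta n (2 * k) *
        (chebMoment k * (discreteChebCoeff f n (2 * k) - chebCoeff f (2 * k))) =
        (∑ k ∈ range (n / 2 + 1), ccDelta n (2 * k) * chebMoment k) *
          (Z * (c * (2 * n : ℝ) ^ (-q))) +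
        ∑ k ∈ range (n / 2 + 1), ccDelta n (2 * k) * (chebMoment k * R k) := by
      rw [sum_mul, ← sum_add_distrib]
      refine sum_congr rfl fun k _ => ?_
      rw [hR]
      ring
    have hmain : |(∑ k ∈ range (n / 2 + 1), ccDelta n (2 * k) * chebMoment k) *
          (Z * (c * (2 * n : ℝ) ^ (-q)))| ≤ 2 * Z * |c| * (Y / n) := by
      rw [abs_mul, abs_mul, abs_mul, abs_of_nonneg hZ0,
        abs_of_nonneg (by positivity : (0 : ℝ) ≤ (2 * n : ℝ) ^ (-q))]
      calc _ ≤ 2 / n * (Z * (|c| * Y)) := by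
            gcongr
            · exact abs_sum_ccDelta_mul_chebMoment_le hn
            · exact hpow _ (by linarith)
        _ = _ := by ring
    have hrem : |∑ k ∈ range (n / 2 + 1), ccDelta n (2 * k) * (chebMoment k * R k)| ≤
        4 * C * (Y / n) := by
      have hterm : ∀ k ∈ range (n / 2 + 1), |ccDelta n (2 * k) * (chebMoment k * R k)| ≤
          C * (Y / n) * (|chebMoment k| + 1 / n) := by
        intro k hk
        have hkn : 2 * k ≤ n := by
          have := mem_range.1 hk
          omega
        rw [abs_mul, abs_mul]
        calc _ ≤ 1 * (|chebMoment k| * (C * (1 + (k : ℝ) ^ 2 / n) * (Y / n))) := by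
              gcongr
              · exact abs_ccDelta_le_one _ _
              · exact hC n k hn0 hM hkn
          _ = C * (Y / n) * (|chebMoment k| + |chebMoment k| * (k : ℝ) ^ 2 / n) := by ring
          _ ≤ _ := by
              gcongr
              exact abs_chebMoment_mul_sq_le k
      refine (abs_sum_le_sum_abs _ _).trans ((sum_le_sum hterm).trans ?_)
      rw [← mul_sum, sum_add_distrib, sum_const, card_range, nsmul_eq_mul]
      have h1 := sum_abs_chebMoment_le (n / 2)
      have h2 : ((n / 2 + 1 : ℕ) : ℝ) * (1 / n) ≤ 1 := by
        rw [mul_one_div, div_le_one hnpos]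
        exact_mod_cast (by omega : n / 2 + 1 ≤ n)
      calc _ ≤ C * (Y / n) * (3 + 1) := by gcongr
        _ = _ := by ring
    rw [hsplit]
    refine (abs_add_le _ _).trans ((add_le_add hmain hrem).trans_eq ?_)
    ring
  rw [ccError_eq f hn0]
  rw [abs_le] at *
  constructor <;> linarith [b1.1, b1.2, b2.1, b2.2, b3.1, b3.2]

/-- If the Chebyshev coefficients of a continuous `f` satisfy
`a_m = c/m^{s+1} + O(m^{−s−2})` or `a_m = (−1)^m c/m^{s+1} + O(m^{−s−2})`,
then `E_n^C[f] = O(n^{−s−2})`. -/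
theorem ccError_isBigO_of_chebCoeff_asymp (f : ℝ → ℝ)
    (hf : ContinuousOn f (Set.Icc (-1) 1)) (s : ℝ) (hs : 0 < s) (c : ℝ)
    (hcheb :
      ((fun m : ℕ => chebCoeff f m - c / (m : ℝ) ^ (s + 1)) =O[atTop]
          fun m : ℕ => (m : ℝ) ^ (-(s + 2))) ∨
      ((fun m : ℕ => chebCoeff f m - (-1 : ℝ) ^ m * c / (m : ℝ) ^ (s + 1)) =O[atTop]
          fun m : ℕ => (m : ℝ) ^ (-(s + 2)))) :
    (fun n : ℕ => ccError f n) =O[atTop] fun n : ℕ => (n : ℝ) ^ (-(s + 2)) := by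
  have hdiv : ∀ x m : ℝ, 0 ≤ m → x / m ^ (s + 1) = x * m ^ (-(s + 1)) := fun x m hm => by
    rw [Real.rpow_neg hm, div_eq_mul_inv]
  obtain ⟨ε, hε, hε_even, hasym⟩ : ∃ ε : ℕ → ℝ, (∀ m, |ε m| = 1) ∧ (∀ m, Even m → ε m = 1) ∧
      (fun m : ℕ => chebCoeff f m - ε m * c / (m : ℝ) ^ (s + 1)) =O[atTop]
        fun m : ℕ => (m : ℝ) ^ (-(s + 2)) := by
    rcases hcheb with h | h
    · exact ⟨fun _ => 1, fun _ => abs_one, fun _ _ => rfl, by simpa using h⟩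
    · exact ⟨fun m => (-1) ^ m, fun m => by simp, fun m hm => hm.neg_one_pow, h⟩
  obtain ⟨B, hB0, hB⟩ := hasym.exists_nonneg
  obtain ⟨M, hM⟩ := eventually_atTop.1 hB.bound
  have hpow : ∀ m : ℕ, m ≠ 0 → (m : ℝ) ^ (-(s + 2)) = (m : ℝ) ^ (-(s + 1)) / m := by
    intro m hm
    have hm0 : (0 : ℝ) < m := by exact_mod_cast Nat.pos_of_ne_zero hm
    rw [← Real.rpow_sub_one hm0.ne']
    congr 1
    ring
  have hdev : ∀ m : ℕ, max M 1 ≤ m → |chebCoeff f m - ε m * (c * (m : ℝ) ^ (-(s + 1)))| ≤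
      B * ((m : ℝ) ^ (-(s + 1)) / m) := by
    intro m hm
    have h := hM m ((le_max_left _ _).trans hm)
    have hm1 : m ≠ 0 := Nat.one_le_iff_ne_zero.1 ((le_max_right _ _).trans hm)
    rwa [Real.norm_eq_abs, Real.norm_eq_abs,
      abs_of_nonneg (by positivity : 0 ≤ (m : ℝ) ^ (-(s + 2))), hpow m hm1,
      hdiv _ _ (by positivity), mul_assoc] at h
  have hb : ∀ m : ℕ, max M 1 ≤ m → |chebCoeff f m| ≤ (B + |c|) * (m : ℝ) ^ (-(s + 1)) := by
    intro m hm
    have hm1 : (1 : ℝ) ≤ m := by exact_mod_cast (le_max_right _ _).trans hm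
    have h0 : 0 ≤ (m : ℝ) ^ (-(s + 1)) := by positivity
    have h1 : |ε m * (c * (m : ℝ) ^ (-(s + 1)))| = |c| * (m : ℝ) ^ (-(s + 1)) := by
      rw [abs_mul, abs_mul, hε, one_mul, abs_of_nonneg h0]
    calc |chebCoeff f m|
        ≤ |chebCoeff f m - ε m * (c * (m : ℝ) ^ (-(s + 1)))| +
          |ε m * (c * (m : ℝ) ^ (-(s + 1)))| := by
          simpa using abs_add_le (chebCoeff f m - ε m * (c * (m : ℝ) ^ (-(s + 1))))
            (ε m * (c * (m : ℝ) ^ (-(s + 1))))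
      _ ≤ B * (m : ℝ) ^ (-(s + 1)) + |c| * (m : ℝ) ^ (-(s + 1)) := by
          rw [h1]
          gcongr
          exact (hdev m hm).trans (mul_le_mul_of_nonneg_left (div_le_self h0 hm1) hB0)
      _ = _ := by ring
  have hsum : Summable (chebCoeff f) := by
    refine summable_of_isBigO_nat
      (Real.summable_nat_rpow.2 (by linarith : -(s + 1) < -1)) ?_
    refine Asymptotics.IsBigO.of_bound (B + |c|) ?_
    filter_upwards [eventually_ge_atTop (max M 1)] with m hm
    rw [Real.norm_eq_abs, Real.norm_eq_abs,
      abs_of_nonneg (by positivity : 0 ≤ (m : ℝ) ^ (-(s + 1)))]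
    exact hb m hm
  obtain ⟨K, hK⟩ := exists_abs_ccError_le (c := c) hf hsum (by linarith : 1 < s + 1)
    (by positivity : 0 ≤ B + |c|) hb fun m hm he => by
      have h := hdev m hm
      rw [hε_even m he, one_mul] at h
      refine h.trans (mul_le_mul_of_nonneg_right ?_ (by positivity))
      linarith [abs_nonneg c]
  refine Asymptotics.IsBigO.of_bound K ?_
  filter_upwards [eventually_ge_atTop (max M 1), eventually_ge_atTop 2] with n hn hn2
  rw [Real.norm_eq_abs, Real.norm_eq_abs,
    abs_of_nonneg (by positivity : 0 ≤ (n : ℝ) ^ (-(s + 2))), hpow n (by omega)]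
  exact hK n hn2 hn
end

section
/- Let s > 0. Then, as n → ∞, the double sum Σ_{j=1}^{∞} Σ_{r ∈ ℤ, 1−n ≤ 2r ≤ n} 2/((4r² − 1)(2jn + 2r)^{s+1}) is O(n^{−s−2}). -/
open Real Filter Finset

theorem exists_rpow_symm_second_difference_bound (p : ℝ) :
    ∃ C : ℝ, 0 ≤ C ∧ ∀ t ∈ Set.Icc (0 : ℝ) (1 / 2),
      |(1 + t) ^ (-p) + (1 - t) ^ (-p) - 2| ≤ C * t ^ 2 := by
  have hF : ContDiffOn ℝ (1 + 1 : ℕ) (fun t : ℝ => (1 + t) ^ (-p) + (1 - t) ^ (-p))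
      (Set.Icc (0 : ℝ) (1 / 2)) := by
    refine ContDiffOn.add (ContDiffOn.rpow_const_of_ne (by fun_prop) ?_)
      (ContDiffOn.rpow_const_of_ne (by fun_prop) ?_)
    · intro x hx
      linarith [hx.1]
    · intro x hx
      linarith [hx.2]
  have hd : HasDerivAt (fun t : ℝ => (1 + t) ^ (-p) + (1 - t) ^ (-p)) 0 0 := by
    have h1 : HasDerivAt (fun t : ℝ => (1 + t) ^ (-p)) (1 * -p * (1 + 0 : ℝ) ^ (-p - 1)) 0 :=
      ((hasDerivAt_id (0 : ℝ)).const_add 1).rpow_const (Or.inl (by norm_num))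
    have h2 : HasDerivAt (fun t : ℝ => (1 - t) ^ (-p)) (-1 * -p * (1 - 0 : ℝ) ^ (-p - 1)) 0 :=
      ((hasDerivAt_id (0 : ℝ)).const_sub 1).rpow_const (Or.inl (by norm_num))
    exact (h1.add h2).congr_deriv (by norm_num)
  obtain ⟨C, hC⟩ := exists_taylor_mean_remainder_bound (by norm_num) hF
  refine ⟨|C|, abs_nonneg C, fun t ht => ?_⟩
  have hdw : derivWithin (fun t : ℝ => (1 + t) ^ (-p) + (1 - t) ^ (-p))
      (Set.Icc (0 : ℝ) (1 / 2)) 0 = 0 :=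
    hd.hasDerivWithinAt.derivWithin
      (uniqueDiffOn_Icc (by norm_num) 0 (by constructor <;> norm_num))
  have h := hC t ht
  rw [taylorWithinEval_succ, taylor_within_zero_eval, iteratedDerivWithin_one, hdw] at h
  norm_num at h
  exact h.trans (by gcongr; exact le_abs_self C)

theorem sum_Icc_neg_two_div_mul (f : ℝ → ℝ) (k : ℕ) :
    ∑ r ∈ Finset.Icc (-(k : ℤ)) (k : ℤ), 2 / (4 * (r : ℝ) ^ 2 - 1) * f r =
      -(2 * f 0 / (2 * (k : ℝ) + 1)) + ∑ i ∈ Finset.range k,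
        2 / (4 * ((i : ℝ) + 1) ^ 2 - 1) * (f (i + 1) + f (-(i + 1)) - 2 * f 0) := by
  induction k with
  | zero => simp; norm_num
  | succ k ih =>
    have hIcc : Finset.Icc (-((k + 1 : ℕ) : ℤ)) ((k + 1 : ℕ) : ℤ) =
        insert ((k : ℤ) + 1) (insert (-((k : ℤ) + 1)) (Finset.Icc (-(k : ℤ)) (k : ℤ))) := by
      ext x
      simp only [Finset.mem_Icc, Finset.mem_insert]
      omega
    rw [hIcc, Finset.sum_insert, Finset.sum_insert, ih, Finset.sum_range_succ]
    · push_cast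
      have hk : (0 : ℝ) ≤ k := k.cast_nonneg
      have h1 : 2 * (k : ℝ) + 1 ≠ 0 := by positivity
      have h2 : 2 * ((k : ℝ) + 1) + 1 ≠ 0 := by positivity
      have h3 : (4 * ((k : ℝ) + 1) ^ 2 - 1) = (2 * (k : ℝ) + 1) * (2 * ((k : ℝ) + 1) + 1) := by
        ring
      rw [neg_sq, h3]
      field_simp
      ring
    · simp only [Finset.mem_Icc]
      omega
    · simp only [Finset.mem_Icc, Finset.mem_insert]
      omega

theorem rpow_neg_symm_second_difference_bound {p C : ℝ}
    (hC : ∀ t ∈ Set.Icc (0 : ℝ) (1 / 2), |(1 + t) ^ (-p) + (1 - t) ^ (-p) - 2| ≤ C * t ^ 2)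
    {N x : ℝ} (hN : 0 < N) (hx : 0 ≤ x) (hxN : 2 * x ≤ N) :
    |(2 * N + 2 * x) ^ (-p) + (2 * N + 2 * -x) ^ (-p) - 2 * (2 * N + 2 * 0) ^ (-p)| ≤
      (2 * N) ^ (-p) * (C * (x / N) ^ 2) := by
  have ht : x / N ≤ 1 / 2 := by
    rw [div_le_iff₀ hN]
    linarith
  have ht0 : 0 ≤ x / N := by positivity
  have e1 : 2 * N + 2 * x = 2 * N * (1 + x / N) := by field_simp
  have e2 : 2 * N + 2 * -x = 2 * N * (1 - x / N) := by field_simp; ring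
  rw [e1, e2, mul_zero, add_zero, mul_rpow (x := 2 * N) (y := 1 + x / N) (by positivity) (by positivity),
    mul_rpow (x := 2 * N) (y := 1 - x / N) (by positivity) (by linarith)]
  have h : (2 * N) ^ (-p) * (1 + x / N) ^ (-p) + (2 * N) ^ (-p) * (1 - x / N) ^ (-p) -
      2 * (2 * N) ^ (-p) =
      (2 * N) ^ (-p) * ((1 + x / N) ^ (-p) + (1 - x / N) ^ (-p) - 2) := by ring
  rw [h, abs_mul, abs_of_pos (rpow_pos_of_pos (by positivity) _)]
  exact mul_le_mul_of_nonneg_left (hC _ ⟨ht0, ht⟩) (by positivity)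

theorem abs_sum_Icc_neg_le {p C : ℝ} (hC0 : 0 ≤ C)
    (hC : ∀ t ∈ Set.Icc (0 : ℝ) (1 / 2), |(1 + t) ^ (-p) + (1 - t) ^ (-p) - 2| ≤ C * t ^ 2)
    {N : ℝ} {k : ℕ} (hN : 0 < N) (hk : 2 * (k : ℝ) ≤ N) :
    |∑ r ∈ Finset.Icc (-(k : ℤ)) (k : ℤ),
        2 / (4 * (r : ℝ) ^ 2 - 1) * (2 * N + 2 * (r : ℝ)) ^ (-p)| ≤
      (2 * N) ^ (-p) * (2 / (2 * (k : ℝ) + 1) + k * (C / N ^ 2)) := by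
  rw [sum_Icc_neg_two_div_mul (fun x => (2 * N + 2 * x) ^ (-p)) k]
  have hf0 : 0 < (2 * N) ^ (-p) := rpow_pos_of_pos (by positivity) _
  have hterm : ∀ i ∈ Finset.range k,
      |2 / (4 * ((i : ℝ) + 1) ^ 2 - 1) * ((2 * N + 2 * ((i : ℝ) + 1)) ^ (-p) +
        (2 * N + 2 * -((i : ℝ) + 1)) ^ (-p) - 2 * (2 * N + 2 * 0) ^ (-p))| ≤
      (2 * N) ^ (-p) * (C / N ^ 2) := by
    intro i hi
    have hik : (i : ℝ) + 1 ≤ k := by exact_mod_cast Finset.mem_range.mp hi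
    have hi0 : (0 : ℝ) ≤ i := i.cast_nonneg
    have hd : 0 < 4 * ((i : ℝ) + 1) ^ 2 - 1 := by nlinarith
    have ha : 2 / (4 * ((i : ℝ) + 1) ^ 2 - 1) * ((i : ℝ) + 1) ^ 2 ≤ 1 := by
      rw [div_mul_eq_mul_div, div_le_one hd]
      nlinarith
    have h := rpow_neg_symm_second_difference_bound hC hN (x := (i : ℝ) + 1)
      (by positivity) (by linarith)
    rw [abs_mul, abs_of_pos (div_pos two_pos hd)]
    calc _ ≤ 2 / (4 * ((i : ℝ) + 1) ^ 2 - 1) *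
          ((2 * N) ^ (-p) * (C * (((i : ℝ) + 1) / N) ^ 2)) :=
          mul_le_mul_of_nonneg_left h (div_pos two_pos hd).le
      _ = (2 / (4 * ((i : ℝ) + 1) ^ 2 - 1) * ((i : ℝ) + 1) ^ 2) *
          ((2 * N) ^ (-p) * (C / N ^ 2)) := by ring
      _ ≤ _ := mul_le_of_le_one_left (by positivity) ha
  refine (abs_add_le _ _).trans ?_
  rw [mul_add]
  refine add_le_add ?_ ((Finset.abs_sum_le_sum_abs _ _).trans ?_)
  · rw [abs_neg, mul_zero, add_zero, abs_of_pos (by positivity)]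
    exact le_of_eq (by ring)
  · refine (Finset.sum_le_sum hterm).trans (le_of_eq ?_)
    rw [Finset.sum_const, Finset.card_range, nsmul_eq_mul]
    ring

theorem abs_sum_filter_le {p C : ℝ} (hp : 0 ≤ p) (hC0 : 0 ≤ C)
    (hC : ∀ t ∈ Set.Icc (0 : ℝ) (1 / 2), |(1 + t) ^ (-p) + (1 - t) ^ (-p) - 2| ≤ C * t ^ 2)
    {N : ℝ} {n : ℕ} (hn : 2 ≤ n) (hnN : (n : ℝ) ≤ N) :
    |∑ r ∈ (Finset.Icc (-(n : ℤ)) (n : ℤ)).filter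
          (fun r => 1 - (n : ℤ) ≤ 2 * r ∧ 2 * r ≤ (n : ℤ)),
        2 / (4 * (r : ℝ) ^ 2 - 1) * (2 * N + 2 * (r : ℝ)) ^ (-p)| ≤
      (2 * N) ^ (-p) * ((6 + C) / n) := by
  have hn2 : (2 : ℝ) ≤ n := by exact_mod_cast hn
  have hN : 0 < N := by linarith
  have hf0 : 0 < (2 * N) ^ (-p) := rpow_pos_of_pos (by positivity) _
  have hsymm : ∀ k : ℕ, (n : ℝ) ≤ 2 * k + 2 → 2 * (k : ℝ) ≤ n →
      |∑ r ∈ Finset.Icc (-(k : ℤ)) (k : ℤ),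
        2 / (4 * (r : ℝ) ^ 2 - 1) * (2 * N + 2 * (r : ℝ)) ^ (-p)| ≤
      (2 * N) ^ (-p) * ((4 + C) / n) := by
    intro k hk1 hk2
    refine (abs_sum_Icc_neg_le hC0 hC hN (hk2.trans hnN)).trans
      (mul_le_mul_of_nonneg_left ?_ hf0.le)
    rw [add_div]
    refine add_le_add ?_ ?_
    · rw [div_le_div_iff₀ (by positivity) (by positivity)]
      linarith
    · calc (k : ℝ) * (C / N ^ 2) ≤ n * (C / (n : ℝ) ^ 2) := by
            have hkn : (k : ℝ) ≤ n := by linarith [(k.cast_nonneg : (0 : ℝ) ≤ k)]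
            gcongr
        _ = C / n := by field_simp
  obtain ⟨m, hm | hm⟩ := Nat.even_or_odd' n
  · obtain ⟨k, rfl⟩ : ∃ k, m = k + 1 := ⟨m - 1, by omega⟩
    have hset : (Finset.Icc (-(n : ℤ)) (n : ℤ)).filter
        (fun r => 1 - (n : ℤ) ≤ 2 * r ∧ 2 * r ≤ (n : ℤ)) =
        insert ((k : ℤ) + 1) (Finset.Icc (-(k : ℤ)) (k : ℤ)) := by
      ext x
      simp only [Finset.mem_filter, Finset.mem_Icc, Finset.mem_insert]
      omega
    have hnk : (n : ℝ) = 2 * ((k : ℝ) + 1) := by exact_mod_cast hm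
    rw [hset, Finset.sum_insert (by simp)]
    refine (abs_add_le _ _).trans ?_
    have hsplit : (2 * N) ^ (-p) * ((6 + C) / n) =
        2 / n * (2 * N) ^ (-p) + (2 * N) ^ (-p) * ((4 + C) / n) := by ring
    rw [hsplit]
    refine add_le_add ?_ (hsymm k (by linarith) (by linarith))
    push_cast
    have h4 : 4 * ((k : ℝ) + 1) ^ 2 - 1 = (n : ℝ) ^ 2 - 1 := by rw [hnk]; ring
    have hd : (n : ℝ) ≤ (n : ℝ) ^ 2 - 1 := by nlinarith
    rw [h4, abs_of_pos (mul_pos (div_pos two_pos (by linarith))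
      (rpow_pos_of_pos (by positivity) _))]
    refine mul_le_mul (by gcongr) ?_ (by positivity) (by positivity)
    exact rpow_le_rpow_of_nonpos (by positivity)
      (by linarith [(k.cast_nonneg : (0 : ℝ) ≤ k)]) (by linarith)
  · have hset : (Finset.Icc (-(n : ℤ)) (n : ℤ)).filter
        (fun r => 1 - (n : ℤ) ≤ 2 * r ∧ 2 * r ≤ (n : ℤ)) = Finset.Icc (-(m : ℤ)) (m : ℤ) := by
      ext x
      simp only [Finset.mem_filter, Finset.mem_Icc]
      omega
    have hnm : (n : ℝ) = 2 * (m : ℝ) + 1 := by exact_mod_cast hm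
    rw [hset]
    refine (hsymm m (by linarith) (by linarith)).trans ?_
    gcongr
    norm_num

/-- For `s > 0`, the double sum
`Σ_{j=1}^{∞} Σ_{r ∈ ℤ, 1−n ≤ 2r ≤ n} 2/((4r² − 1)(2jn + 2r)^{s+1})`
is `O(n^{−s−2})` as `n → ∞`. -/
theorem doubleSum_isBigO (s : ℝ) (hs : 0 < s) :
    (fun n : ℕ => ∑' j : ℕ,
        ∑ r ∈ (Finset.Icc (-(n : ℤ)) (n : ℤ)).filter
            (fun r => 1 - (n : ℤ) ≤ 2 * r ∧ 2 * r ≤ (n : ℤ)),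
          2 / ((4 * (r : ℝ) ^ 2 - 1) *
            (2 * ((j : ℝ) + 1) * (n : ℝ) + 2 * (r : ℝ)) ^ (s + 1)))
      =O[atTop] fun n : ℕ => (n : ℝ) ^ (-(s + 2)) := by
  obtain ⟨C, hC0, hC⟩ := exists_rpow_symm_second_difference_bound (s + 1)
  have hsum : Summable fun j : ℕ => ((j : ℝ) + 1) ^ (-(s + 1)) := by
    have h := (summable_nat_add_iff 1).mpr
      (Real.summable_nat_rpow.mpr (show -(s + 1) < -1 by linarith))
    simpa using h
  refine Asymptotics.IsBigO.of_bound
    ((∑' j : ℕ, ((j : ℝ) + 1) ^ (-(s + 1))) * (6 + C)) ?_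
  filter_upwards [eventually_ge_atTop 2] with n hn
  have hn0 : (0 : ℝ) < n := by exact_mod_cast (by omega : 0 < n)
  have hpow : (n : ℝ) ^ (-(s + 2)) = (n : ℝ) ^ (-(s + 1)) / n := by
    rw [← rpow_sub_one hn0.ne']
    congr 1
    ring
  rw [Real.norm_of_nonneg (by positivity : (0 : ℝ) ≤ (n : ℝ) ^ (-(s + 2))), mul_assoc]
  refine tsum_of_norm_bounded (hsum.hasSum.mul_right ((6 + C) * (n : ℝ) ^ (-(s + 2)))) ?_
  intro j
  have hj : (0 : ℝ) ≤ j := j.cast_nonneg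
  have hnN : (n : ℝ) ≤ ((j : ℝ) + 1) * n := by nlinarith
  have hbound := abs_sum_filter_le (by linarith) hC0 hC hn hnN
  rw [Real.norm_eq_abs]
  calc _ = |∑ r ∈ (Finset.Icc (-(n : ℤ)) (n : ℤ)).filter
          (fun r => 1 - (n : ℤ) ≤ 2 * r ∧ 2 * r ≤ (n : ℤ)),
        2 / (4 * (r : ℝ) ^ 2 - 1) * (2 * (((j : ℝ) + 1) * n) + 2 * (r : ℝ)) ^ (-(s + 1))| := by
        congr 1
        refine Finset.sum_congr rfl fun r hr => ?_
        have hr1 : (1 : ℝ) - n ≤ 2 * r := by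
          exact_mod_cast (Finset.mem_filter.mp hr).2.1
        rw [rpow_neg (by nlinarith), ← div_eq_mul_inv, div_div, mul_assoc 2]
    _ ≤ (2 * (((j : ℝ) + 1) * n)) ^ (-(s + 1)) * ((6 + C) / n) := hbound
    _ ≤ (((j : ℝ) + 1) * n) ^ (-(s + 1)) * ((6 + C) / n) := by
        refine mul_le_mul_of_nonneg_right ?_ (by positivity)
        exact rpow_le_rpow_of_nonpos (by positivity)
          (by nlinarith) (by linarith)
    _ = _ := by
        rw [mul_rpow (by positivity) hn0.le, hpow]
        ring
end

section
/- Let n ≥ 1 and let m = 2jn + 2r where j ≥ 1 is an integer and r is an integer with 1 − n ≤ 2r ≤ n. Then the error of the (n+1)-point Clenshaw–Curtis quadrature rule applied to the Chebyshev polynomial T_m satisfies E_n^C[T_m] = 2/(1 − m²) − 2/(1 − 4r²). -/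
open Real Filter Finset

theorem sum_range_ccDelta_mul {n : ℕ} (hn : 1 ≤ n) (f : ℕ → ℝ) (hf : f n = f 0) :
    ∑ i ∈ Finset.range (n + 1), ccDelta n i * f i = ∑ i ∈ Finset.range n, f i := by
  obtain ⟨p, rfl⟩ := Nat.exists_eq_add_of_le' hn
  rw [Finset.sum_range_succ, Finset.sum_range_succ', Finset.sum_range_succ' f]
  have h : ∀ i ∈ Finset.range p, ccDelta (p + 1) (i + 1) * f (i + 1) = f (i + 1) := by
    intro i hi
    have : i ≠ p := (Finset.mem_range.mp hi).ne
    simp [ccDelta, this]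
  rw [Finset.sum_congr rfl h, hf]
  simp only [ccDelta]
  norm_num
  ring

theorem two_mul_sin_mul_sum_range_cos (x : ℝ) (n : ℕ) :
    2 * sin x * ∑ i ∈ Finset.range n, cos (2 * x * i) = sin (2 * n * x - x) + sin x := by
  induction n with
  | zero => simp
  | succ n ih =>
    have h₁ : sin (2 * ((n + 1 : ℕ) : ℝ) * x - x) = sin (2 * x * n + x) := by
      congr 1; push_cast; ring
    have h₂ : sin (2 * (n : ℝ) * x - x) = sin (2 * x * n - x) := by
      congr 1; ring
    rw [Finset.sum_range_succ, mul_add, ih, h₁, h₂, sin_add, sin_sub]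
    ring

theorem sum_range_cos_two_pi_mul_div {n : ℕ} (hn : 1 ≤ n) (a : ℤ) :
    ∑ i ∈ Finset.range n, cos (2 * (a * π / n) * i) = if (n : ℤ) ∣ a then (n : ℝ) else 0 := by
  have hn' : (n : ℝ) ≠ 0 := by positivity
  split_ifs with h
  · obtain ⟨b, rfl⟩ := h
    have : ∀ i ∈ Finset.range n, cos (2 * (((n * b : ℤ) : ℝ) * π / n) * i) = 1 := by
      intro i _
      rw [← cos_int_mul_two_pi (b * i)]
      congr 1
      push_cast
      field_simp
    rw [Finset.sum_congr rfl this]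
    simp
  · have hs : sin (a * π / n) ≠ 0 := by
      rw [Ne, sin_eq_zero_iff]
      rintro ⟨b, hb⟩
      apply h
      refine ⟨b, ?_⟩
      field_simp at hb
      have : (a : ℝ) = n * b := by linarith
      exact_mod_cast this
    have key := two_mul_sin_mul_sum_range_cos (a * π / n) n
    have hx : 2 * (n : ℝ) * (a * π / n) - a * π / n = a * (2 * π) - a * π / n := by
      field_simp
    rw [hx, sin_int_mul_two_pi_sub, neg_add_cancel] at key
    simpa [hs] using key

theorem sum_ccDelta_mul_cos_mul_cos {n : ℕ} (hn : 1 ≤ n) {k s : ℕ} (hk : 2 * k ≤ n)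
    (hs : 2 * s ≤ n) :
    ccDelta n (2 * k) * ∑ i ∈ Finset.range (n + 1), ccDelta n i *
      (cos (2 * i * k * π / n) * cos (2 * i * s * π / n)) = if k = s then (n : ℝ) / 2 else 0 := by
  have hn' : (n : ℝ) ≠ 0 := by positivity
  have hprod : ∀ i : ℕ, cos (2 * (i : ℝ) * k * π / n) * cos (2 * (i : ℝ) * s * π / n) =
      (cos (2 * (((k + s : ℤ) : ℝ) * π / n) * i) +
        cos (2 * (((k - s : ℤ) : ℝ) * π / n) * i)) / 2 := by
    intro i
    have h₁ : 2 * (((k + s : ℤ) : ℝ) * π / n) * i =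
        2 * (i : ℝ) * k * π / n + 2 * (i : ℝ) * s * π / n := by push_cast; ring
    have h₂ : 2 * (((k - s : ℤ) : ℝ) * π / n) * i =
        2 * (i : ℝ) * k * π / n - 2 * (i : ℝ) * s * π / n := by push_cast; ring
    rw [h₁, h₂, cos_add, cos_sub]
    ring
  have hper : ∀ a : ℕ, cos (2 * (n : ℝ) * a * π / n) = 1 := by
    intro a
    rw [← cos_nat_mul_two_pi a]
    congr 1
    field_simp
  rw [sum_range_ccDelta_mul hn (fun i : ℕ => cos (2 * (i : ℝ) * k * π / n) *
    cos (2 * (i : ℝ) * s * π / n)) (by simp [hper])]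
  simp only [hprod]
  rw [← Finset.sum_div, Finset.sum_add_distrib, sum_range_cos_two_pi_mul_div hn,
    sum_range_cos_two_pi_mul_div hn]
  have hsub : (n : ℤ) ∣ k - s ↔ k = s := by
    constructor
    · intro h
      have := Int.eq_zero_of_abs_lt_dvd h (by rw [abs_lt]; omega)
      omega
    · rintro rfl; simp
  have hadd : (n : ℤ) ∣ k + s ↔ k = s ∧ (2 * k = 0 ∨ 2 * k = n) := by
    constructor
    · rintro ⟨c, hc⟩
      have hc0 : 0 ≤ c := by by_contra! hc'; nlinarith
      have hc1 : c ≤ 1 := by by_contra! hc'; nlinarith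
      have : c = 0 ∨ c = 1 := by omega
      rcases this with rfl | rfl <;> omega
    · rintro ⟨rfl, h | h⟩
      · simp [show k = 0 by omega]
      · exact ⟨1, by omega⟩
  simp only [hsub, hadd, ccDelta]
  by_cases hks : k = s
  · subst hks
    by_cases h : 2 * k = 0 ∨ 2 * k = n
    · rw [if_pos h, if_pos ⟨rfl, h⟩, if_pos rfl, if_pos rfl]
      ring
    · rw [if_neg h, if_neg (fun h' => h h'.2), if_pos rfl, if_pos rfl]
      ring
  · simp [hks]

theorem integral_eval_chebyshevT_of_even {m : ℤ} (hm : Even m) :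
    ∫ x in (-1 : ℝ)..1, (Polynomial.Chebyshev.T ℝ m).eval x = 2 / (1 - (m : ℝ) ^ 2) := by
  have h₁ : (m : ℝ) + 1 ≠ 0 := by
    have : m + 1 ≠ 0 := by grind
    exact_mod_cast this
  have h₂ : (m : ℝ) - 1 ≠ 0 := by
    have : m - 1 ≠ 0 := by grind
    exact_mod_cast this
  have h₃ : 1 - (m : ℝ) ^ 2 ≠ 0 := by
    rw [show 1 - (m : ℝ) ^ 2 = -((m + 1) * (m - 1)) by ring]
    exact neg_ne_zero.mpr (mul_ne_zero h₁ h₂)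
  have hderiv : ∀ x : ℝ, HasDerivAt (fun x : ℝ =>
      (Polynomial.Chebyshev.T ℝ (m + 1)).eval x / (2 * (m + 1)) -
        (Polynomial.Chebyshev.T ℝ (m - 1)).eval x / (2 * (m - 1)))
      ((Polynomial.Chebyshev.T ℝ m).eval x) x := by
    intro x
    have hU : 2 * (Polynomial.Chebyshev.T ℝ m).eval x =
        (Polynomial.Chebyshev.U ℝ m).eval x - (Polynomial.Chebyshev.U ℝ (m - 2)).eval x := by
      have e₁ := congrArg (Polynomial.eval x) (Polynomial.Chebyshev.T_eq_U_sub_X_mul_U ℝ m)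
      have e₂ := congrArg (Polynomial.eval x) (Polynomial.Chebyshev.U_eq ℝ m)
      simp at e₁ e₂
      linarith
    refine ((((Polynomial.Chebyshev.T ℝ (m + 1)).hasDerivAt x).div_const (2 * (m + 1))).fun_sub
      (((Polynomial.Chebyshev.T ℝ (m - 1)).hasDerivAt x).div_const
        (2 * (m - 1)))).congr_deriv ?_
    rw [Polynomial.Chebyshev.T_derivative_eq_U, Polynomial.Chebyshev.T_derivative_eq_U,
      show m + 1 - 1 = m by ring, show m - 1 - 1 = m - 2 by ring]
    simp
    field_simp
    linarith
  rw [intervalIntegral.integral_eq_sub_of_hasDerivAt (fun x _ => hderiv x)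
    ((Polynomial.continuous _).intervalIntegrable _ _)]
  have hodd₁ : Odd (m + 1) := hm.add_one
  have hodd₂ : Odd (m - 1) := hm.sub_odd odd_one
  simp [Int.negOnePow_odd _ hodd₁,
    Int.negOnePow_odd _ hodd₂]
  field_simp
  ring

theorem ccQuad_chebyshevT {n : ℕ} (hn : 1 ≤ n) (j r : ℤ) {s : ℕ} (hs : 2 * s ≤ n)
    (hrs : |r| = s) :
    ccQuad (fun x => (Polynomial.Chebyshev.T ℝ (2 * j * n + 2 * r)).eval x) n =
      2 / (1 - 4 * (s : ℝ) ^ 2) := by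
  have hn' : (n : ℝ) ≠ 0 := by positivity
  have halias : ∀ i : ℕ, cos (((2 * j * n + 2 * r : ℤ) : ℝ) * (i * π / n)) =
      cos (2 * i * s * π / n) := by
    intro i
    have h₁ : ((2 * j * n + 2 * r : ℤ) : ℝ) * (i * π / n) =
        2 * i * r * π / n + ((j * i : ℤ) : ℝ) * (2 * π) := by
      push_cast
      field_simp
      ring
    rw [h₁, cos_add_int_mul_two_pi]
    have hsr : (s : ℝ) = |(r : ℝ)| := by exact_mod_cast hrs.symm
    rcases abs_choice (r : ℝ) with h | h <;> rw [hsr, h]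
    rw [← cos_neg]
    congr 1
    ring
  have hswap : ccQuad (fun x => (Polynomial.Chebyshev.T ℝ (2 * j * n + 2 * r)).eval x) n =
      ∑ k ∈ Finset.range (n / 2 + 1), 4 / (n : ℝ) / (1 - 4 * (k : ℝ) ^ 2) *
        (ccDelta n (2 * k) * ∑ i ∈ Finset.range (n + 1), ccDelta n i *
          (cos (2 * i * k * π / n) * cos (2 * i * s * π / n))) := by
    simp only [ccQuad, ccWeight, Polynomial.Chebyshev.T_real_cos, halias, Finset.mul_sum,
      Finset.sum_mul]
    rw [Finset.sum_comm]
    refine Finset.sum_congr rfl fun k _ => Finset.sum_congr rfl fun i _ => ?_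
    ring
  have hterm : ∀ k ∈ Finset.range (n / 2 + 1), 4 / (n : ℝ) / (1 - 4 * (k : ℝ) ^ 2) *
        (ccDelta n (2 * k) * ∑ i ∈ Finset.range (n + 1), ccDelta n i *
          (cos (2 * i * k * π / n) * cos (2 * i * s * π / n))) =
      if k = s then 2 / (1 - 4 * (s : ℝ) ^ 2) else 0 := by
    intro k hk
    rw [Finset.mem_range] at hk
    rw [sum_ccDelta_mul_cos_mul_cos hn (by omega) hs]
    split_ifs with h
    · rw [h, div_div, div_mul_div_comm, mul_comm (n : ℝ) (1 - _), mul_assoc,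
        mul_comm (n : ℝ) 2, ← mul_assoc, mul_div_mul_right _ _ hn', mul_comm _ (2 : ℝ),
        show (4 : ℝ) = 2 * 2 by norm_num, mul_div_mul_left _ _ two_ne_zero]
    · simp
  rw [hswap, Finset.sum_congr rfl hterm, Finset.sum_ite_eq', if_pos]
  rw [Finset.mem_range]
  omega

/-- Aliasing formula: for `n ≥ 1`, `j ≥ 1` and `r ∈ ℤ` with `1 − n ≤ 2r ≤ n`, the
Clenshaw–Curtis error for the Chebyshev polynomial `T_m` with `m = 2jn + 2r` is
`E_n^C[T_m] = 2/(1 − m²) − 2/(1 − 4r²)`. -/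
theorem ccError_chebyshevT (n : ℕ) (hn : 1 ≤ n) (j : ℕ) (hj : 1 ≤ j) (r : ℤ)
    (hr1 : 1 - (n : ℤ) ≤ 2 * r) (hr2 : 2 * r ≤ (n : ℤ)) :
    ccError (fun x => (Polynomial.Chebyshev.T ℝ (2 * (j : ℤ) * (n : ℤ) + 2 * r)).eval x) n =
      2 / (1 - (2 * (j : ℝ) * (n : ℝ) + 2 * (r : ℝ)) ^ 2) - 2 / (1 - 4 * (r : ℝ) ^ 2) := by
  have hs : 2 * r.natAbs ≤ n := by omega
  have hrs : |r| = (r.natAbs : ℤ) := Int.abs_eq_natAbs r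
  have hsq : ((r.natAbs : ℕ) : ℝ) ^ 2 = (r : ℝ) ^ 2 := by
    rw [Nat.cast_natAbs, Int.cast_abs, sq_abs]
  rw [ccError, ccQuad_chebyshevT hn j r hs hrs, hsq, integral_eval_chebyshevT_of_even
    (⟨j * n + r, by ring⟩ : Even (2 * (j : ℤ) * n + 2 * r))]
  push_cast
  rfl
end

section
/- Let α, β > −1/2 and let g be infinitely differentiable on [−1,1]. Define ĝ(t) = (t^{−1} sin(t/2))^{2α} ((π − t)^{−1} cos(t/2))^{2β} g(cos t), ψ̂(t) = (π − t)^{2β} ĝ(t), and φ̂(t) = t^{2α} ĝ(t). Then ψ̂ extends to a function infinitely differentiable at t = 0 satisfying ψ̂(−t) = ψ̂(t), so that ψ̂^{(2k+1)}(0) = 0 for all k ≥ 0, and φ̂ extends to a function infinitely differentiable at t = π satisfying φ̂(π + t) = φ̂(π − t), so that φ̂^{(2k+1)}(π) = 0 for all k ≥ 0. Moreover ψ̂(0) = g(1)/2^{2α}, φ̂(π) = g(−1)/2^{2β}, ψ̂''(0) = −(g(1)/2^{2α+1})(α/3 + β) − g'(1)/2^{2α}, and φ̂''(π) = −(g(−1)/2^{2β+1})(α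 + β/3) + g'(−1)/2^{2β}. -/
open Real Filter Finset

namespace Real

theorem contDiff_sinc {n : WithTop ℕ∞} : ContDiff ℝ n sinc := by
  have h0 : AnalyticAt ℝ sinc 0 := by
    obtain ⟨p, hp⟩ := (analyticAt_sin : AnalyticAt ℝ sin 0)
    rw [sinc_eq_dslope]
    exact hp.has_fpower_series_dslope_fslope.analyticAt
  rw [contDiff_iff_contDiffAt]
  intro x
  by_cases hx : x = 0
  · subst hx
    exact h0.contDiffAt
  · have h : ContDiffAt ℝ n (fun y => sin y / y) x :=
      contDiff_sin.contDiffAt.div contDiffAt_id hx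
    refine h.congr_of_eventuallyEq ?_
    filter_upwards [isOpen_ne.mem_nhds hx] with y hy using sinc_of_ne_zero hy

theorem mul_sinc (x : ℝ) : x * sinc x = sin x := by
  by_cases hx : x = 0
  · simp [hx]
  · rw [sinc_of_ne_zero hx, mul_div_cancel₀ _ hx]

theorem iteratedDeriv_two_sinc_zero : iteratedDeriv 2 sinc 0 = -(1 / 3) := by
  have h := congrArg (fun f : ℝ → ℝ => iteratedDeriv 3 f 0) (funext mul_sinc)
  rw [iteratedDeriv_fun_mul contDiffAt_fun_id contDiff_sinc.contDiffAt] at h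
  have hs : iteratedDeriv 3 sin (0 : ℝ) = -1 := by
    simp [iteratedDeriv_succ]
  rw [hs] at h
  simp [Finset.sum_range_succ, iteratedDeriv_fun_id] at h
  linarith

end Real

theorem iteratedDeriv_odd_eq_zero_of_even {f : ℝ → ℝ} (hf : ∀ t, f (-t) = f t) (k : ℕ) :
    iteratedDeriv (2 * k + 1) f 0 = 0 := by
  have h := iteratedDeriv_comp_neg (2 * k + 1) f 0
  rw [funext hf, (odd_two_mul_add_one k).neg_one_pow, neg_zero] at h
  simp only [smul_eq_mul] at h
  linarith

theorem deriv_zero_eq_zero_of_even {f : ℝ → ℝ} (hf : ∀ t, f (-t) = f t) : deriv f 0 = 0 := by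
  simpa using iteratedDeriv_odd_eq_zero_of_even hf 0

theorem iteratedDeriv_two_mul_of_deriv_eq_zero {f g : ℝ → ℝ} {x : ℝ}
    (hf : ContDiffAt ℝ 2 f x) (hg : ContDiffAt ℝ 2 g x) (hf' : deriv f x = 0) :
    iteratedDeriv 2 (fun t => f t * g t) x =
      iteratedDeriv 2 f x * g x + f x * iteratedDeriv 2 g x := by
  rw [iteratedDeriv_fun_mul hf hg]
  simp [Finset.sum_range_succ, hf']
  ring

theorem iteratedDeriv_two_rpow_const_of_deriv_eq_zero {f : ℝ → ℝ} {x : ℝ}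
    (hf : ContDiffAt ℝ 2 f x) (hpos : 0 < f x) (hf' : deriv f x = 0) (p : ℝ) :
    iteratedDeriv 2 (fun t => f t ^ p) x = p * f x ^ (p - 1) * iteratedDeriv 2 f x := by
  have hev : deriv (fun t => f t ^ p) =ᶠ[nhds x]
      fun t => deriv f t * (p * f t ^ (p - 1)) := by
    filter_upwards [hf.continuousAt.eventually (lt_mem_nhds hpos),
      hf.eventually (by simp)] with t ht hft
    rw [deriv_rpow_const (hft.differentiableAt (by simp)) (Or.inl ht.ne')]
    ring
  have hd : DifferentiableAt ℝ (deriv f) x :=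
    (hf.derivWithin (m := 1) (by norm_num)).differentiableAt (by simp)
  have hr : DifferentiableAt ℝ (fun t => p * f t ^ (p - 1)) x :=
    ((hf.differentiableAt (by simp)).rpow_const (Or.inl hpos.ne')).const_mul p
  simp only [iteratedDeriv_succ, iteratedDeriv_zero]
  rw [hev.deriv_eq, deriv_fun_mul hd hr, hf']
  ring

theorem iteratedDeriv_two_comp_cos_zero {g : ℝ → ℝ} (hg : ContDiffOn ℝ 2 g (Set.Icc (-1) 1)) :
    iteratedDeriv 2 (fun t => g (cos t)) 0 = -derivWithin g (Set.Icc (-1) 1) 1 := by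
  set g' := derivWithin g (Set.Icc (-1) 1)
  have hg' : DifferentiableOn ℝ g' (Set.Icc (-1) 1) :=
    (hg.derivWithin (m := 1) (uniqueDiffOn_Icc (by norm_num)) (by norm_num)).differentiableOn
      (by simp)
  have hcos : ∀ t, ∀ᶠ s in nhds t, cos s ∈ Set.Icc (-1 : ℝ) 1 :=
    fun t => Eventually.of_forall cos_mem_Icc
  have h1 : deriv (fun t => g (cos t)) = fun t => g' (cos t) * -sin t := funext fun t =>
    ((hg.differentiableOn (by simp) _ (cos_mem_Icc t)).hasDerivWithinAt.comp_hasDerivAt t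
      (hasDerivAt_cos t) (hcos t)).deriv
  have h2 := ((hg' _ (cos_mem_Icc 0)).hasDerivWithinAt.comp_hasDerivAt 0
      (hasDerivAt_cos 0) (hcos 0)).mul (hasDerivAt_sin 0).neg
  simp only [iteratedDeriv_succ, iteratedDeriv_zero]
  rw [h1]
  refine h2.deriv.trans ?_
  simp

/-- The even function on `ℝ` that extends `ψ̂`. -/
noncomputable def psiExtension (α β : ℝ) (g : ℝ → ℝ) (t : ℝ) : ℝ :=
  (sinc (t / 2) / 2) ^ (2 * α) * (cos (t / 2) ^ (2 * β) * g (cos t))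

theorem psiExtension_eq (α β : ℝ) (g : ℝ → ℝ) {t : ℝ} (ht : t ∈ Set.Ioo (0 : ℝ) π) :
    psiExtension α β g t = (π - t) ^ (2 * β) *
      ((sin (t / 2) / t) ^ (2 * α) * (cos (t / 2) / (π - t)) ^ (2 * β) * g (cos t)) := by
  obtain ⟨h0, hπ⟩ := ht
  have hs : sinc (t / 2) / 2 = sin (t / 2) / t := by
    rw [sinc_of_ne_zero (by positivity)]
    field_simp
  have hc : 0 ≤ cos (t / 2) := cos_nonneg_of_mem_Icc ⟨by linarith, by linarith⟩
  have hsub : 0 < π - t := sub_pos.2 hπ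
  have hne : (π - t) ^ (2 * β) ≠ 0 := (rpow_pos_of_pos hsub _).ne'
  rw [psiExtension, hs, div_rpow hc hsub.le]
  field_simp

theorem psiExtension_neg (α β : ℝ) (g : ℝ → ℝ) (t : ℝ) :
    psiExtension α β g (-t) = psiExtension α β g t := by
  simp [psiExtension, neg_div]

theorem psiExtension_zero (α β : ℝ) (g : ℝ → ℝ) :
    psiExtension α β g 0 = g 1 / 2 ^ (2 * α) := by
  simp [psiExtension, inv_rpow, div_eq_inv_mul]

theorem contDiff_comp_cos {n : WithTop ℕ∞} {g : ℝ → ℝ}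
    (hg : ContDiffOn ℝ n g (Set.Icc (-1) 1)) : ContDiff ℝ n fun t => g (cos t) :=
  hg.comp_contDiff contDiff_cos cos_mem_Icc

theorem contDiff_sinc_half {n : WithTop ℕ∞} : ContDiff ℝ n fun t => sinc (t / 2) / 2 :=
  (contDiff_sinc.comp (contDiff_id.div_const 2)).div_const 2

theorem contDiff_cos_half {n : WithTop ℕ∞} : ContDiff ℝ n fun t : ℝ => cos (t / 2) :=
  contDiff_cos.comp (contDiff_id.div_const 2)

theorem contDiffAt_sinc_half_rpow {n : WithTop ℕ∞} (p : ℝ) :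
    ContDiffAt ℝ n (fun t => (sinc (t / 2) / 2) ^ p) 0 :=
  contDiff_sinc_half.contDiffAt.rpow_const_of_ne (by simp)

theorem contDiffAt_cos_half_rpow {n : WithTop ℕ∞} (p : ℝ) :
    ContDiffAt ℝ n (fun t : ℝ => cos (t / 2) ^ p) 0 :=
  contDiff_cos_half.contDiffAt.rpow_const_of_ne (by simp)

theorem contDiffAt_psiExtension {n : WithTop ℕ∞} (α β : ℝ) {g : ℝ → ℝ}
    (hg : ContDiffOn ℝ n g (Set.Icc (-1) 1)) : ContDiffAt ℝ n (psiExtension α β g) 0 :=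
  (contDiffAt_sinc_half_rpow _).mul
    ((contDiffAt_cos_half_rpow _).mul (contDiff_comp_cos hg).contDiffAt)

theorem iteratedDeriv_two_sinc_half_rpow (p : ℝ) :
    iteratedDeriv 2 (fun t => (sinc (t / 2) / 2) ^ p) 0 = -(p / 12) / 2 ^ p := by
  have h : iteratedDeriv 2 (fun t => sinc (t / 2) / 2) 0 = -(1 / 24) := by
    have := congrFun (iteratedDeriv_comp_const_mul (n := 2) contDiff_sinc (1 / 2)) 0
    simp only [one_div_mul_eq_div] at this
    rw [iteratedDeriv_div_const, this, zero_div, iteratedDeriv_two_sinc_zero]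
    norm_num
  rw [iteratedDeriv_two_rpow_const_of_deriv_eq_zero contDiff_sinc_half.contDiffAt (by simp)
    (deriv_zero_eq_zero_of_even fun t => by simp [neg_div]), h]
  simp only [zero_div, sinc_zero, one_div]
  rw [rpow_sub_one (by norm_num), inv_rpow (by norm_num)]
  ring

theorem iteratedDeriv_two_cos_half_rpow (p : ℝ) :
    iteratedDeriv 2 (fun t : ℝ => cos (t / 2) ^ p) 0 = -(p / 4) := by
  have h : iteratedDeriv 2 (fun t : ℝ => cos (t / 2)) 0 = -(1 / 4) := by
    have := congrFun (iteratedDeriv_comp_const_mul (n := 2) contDiff_cos (1 / 2)) 0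
    simp only [one_div_mul_eq_div] at this
    rw [this]
    simp [iteratedDeriv_succ]
    norm_num
  rw [iteratedDeriv_two_rpow_const_of_deriv_eq_zero contDiff_cos_half.contDiffAt (by simp)
    (deriv_zero_eq_zero_of_even fun t => by simp [neg_div]), h]
  simp
  ring

theorem iteratedDeriv_two_psiExtension (α β : ℝ) {g : ℝ → ℝ}
    (hg : ContDiffOn ℝ 2 g (Set.Icc (-1) 1)) :
    iteratedDeriv 2 (psiExtension α β g) 0 =
      -(g 1 / 2 ^ (2 * α + 1)) * (α / 3 + β) -
        derivWithin g (Set.Icc (-1) 1) 1 / 2 ^ (2 * α) := by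
  have hgc : ContDiffAt ℝ 2 (fun t => g (cos t)) 0 := (contDiff_comp_cos hg).contDiffAt
  unfold psiExtension
  rw [iteratedDeriv_two_mul_of_deriv_eq_zero (contDiffAt_sinc_half_rpow _)
      ((contDiffAt_cos_half_rpow _).mul hgc)
      (deriv_zero_eq_zero_of_even fun t => by simp [neg_div]),
    iteratedDeriv_two_mul_of_deriv_eq_zero (contDiffAt_cos_half_rpow _) hgc
      (deriv_zero_eq_zero_of_even fun t => by simp [neg_div]),
    iteratedDeriv_two_sinc_half_rpow, iteratedDeriv_two_cos_half_rpow,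
    iteratedDeriv_two_comp_cos_zero hg, rpow_add_one (by norm_num)]
  simp only [zero_div, sinc_zero, cos_zero, one_rpow, one_div]
  rw [inv_rpow (by norm_num)]
  have h2 : (2 : ℝ) ^ (2 * α) ≠ 0 := by positivity
  field_simp
  ring

/-- For `α, β > −1/2` and `g` smooth on `[−1,1]`, with
`ĝ(t) = (t⁻¹ sin(t/2))^{2α} ((π−t)⁻¹ cos(t/2))^{2β} g(cos t)`:
the function `ψ̂(t) = (π−t)^{2β} ĝ(t)` extends to a function `Ψ` infinitely
differentiable at `t = 0` with `Ψ(−t) = Ψ(t)`, so all odd derivatives of `Ψ` at `0`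
vanish, and `Ψ(0) = g(1)/2^{2α}`,
`Ψ''(0) = −(g(1)/2^{2α+1})(α/3 + β) − g'(1)/2^{2α}`; similarly the function
`φ̂(t) = t^{2α} ĝ(t)` extends to a function `Φ` infinitely differentiable at `t = π`
with `Φ(π+t) = Φ(π−t)`, so all odd derivatives of `Φ` at `π` vanish, and
`Φ(π) = g(−1)/2^{2β}`, `Φ''(π) = −(g(−1)/2^{2β+1})(α + β/3) + g'(−1)/2^{2β}`. -/
theorem psiHat_phiHat_extensions (α β : ℝ) (hα : -1/2 < α) (hβ : -1/2 < β)
    (g : ℝ → ℝ) (hg : ContDiffOn ℝ (⊤ : ℕ∞) g (Set.Icc (-1) 1)) :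
    (∃ Ψ : ℝ → ℝ,
      (∀ t ∈ Set.Ioo (0 : ℝ) π, Ψ t = (π - t) ^ (2 * β) *
        ((Real.sin (t / 2) / t) ^ (2 * α) * (Real.cos (t / 2) / (π - t)) ^ (2 * β) *
          g (Real.cos t))) ∧
      ContDiffAt ℝ (⊤ : ℕ∞) Ψ 0 ∧ (∀ t : ℝ, Ψ (-t) = Ψ t) ∧
      (∀ k : ℕ, iteratedDeriv (2 * k + 1) Ψ 0 = 0) ∧
      Ψ 0 = g 1 / 2 ^ (2 * α) ∧
      iteratedDeriv 2 Ψ 0 =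
        -(g 1 / 2 ^ (2 * α + 1)) * (α / 3 + β) -
          derivWithin g (Set.Icc (-1) 1) 1 / 2 ^ (2 * α)) ∧
    (∃ Φ : ℝ → ℝ,
      (∀ t ∈ Set.Ioo (0 : ℝ) π, Φ t = t ^ (2 * α) *
        ((Real.sin (t / 2) / t) ^ (2 * α) * (Real.cos (t / 2) / (π - t)) ^ (2 * β) *
          g (Real.cos t))) ∧
      ContDiffAt ℝ (⊤ : ℕ∞) Φ π ∧ (∀ t : ℝ, Φ (π + t) = Φ (π - t)) ∧
      (∀ k : ℕ, iteratedDeriv (2 * k + 1) Φ π = 0) ∧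
      Φ π = g (-1) / 2 ^ (2 * β) ∧
      iteratedDeriv 2 Φ π =
        -(g (-1) / 2 ^ (2 * β + 1)) * (α + β / 3) +
          derivWithin g (Set.Icc (-1) 1) (-1) / 2 ^ (2 * β)) := by
  have h2 : (2 : WithTop ℕ∞) ≤ ((⊤ : ℕ∞) : WithTop ℕ∞) :=
    WithTop.coe_le_coe.2 (le_top : (2 : ℕ∞) ≤ ⊤)
  refine ⟨⟨psiExtension α β g, fun t ht => psiExtension_eq α β g ht,
    contDiffAt_psiExtension α β hg, psiExtension_neg α β g,
    iteratedDeriv_odd_eq_zero_of_even (psiExtension_neg α β g), psiExtension_zero α β g,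
    iteratedDeriv_two_psiExtension α β (hg.of_le h2)⟩, ?_⟩
  have hneg : ContDiffOn ℝ (⊤ : ℕ∞) (fun x => g (-x)) (Set.Icc (-1) 1) :=
    hg.comp contDiff_neg.contDiffOn fun x hx => ⟨by linarith [hx.2], by linarith [hx.1]⟩
  set Ψ := psiExtension β α fun x => g (-x) with hΨ
  have hsmooth : ContDiffAt ℝ (⊤ : ℕ∞) Ψ 0 := contDiffAt_psiExtension β α hneg
  have heven : ∀ t, Ψ (-t) = Ψ t := psiExtension_neg β α _
  refine ⟨fun t => Ψ (π - t), fun t ht => ?_, ?_, fun t => ?_, fun k => ?_, ?_, ?_⟩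
  · have h := psiExtension_eq β α (fun x => g (-x)) (t := π - t)
      ⟨by linarith [ht.2], by linarith [ht.1]⟩
    have hhalf : (π - t) / 2 = π / 2 - t / 2 := by ring
    refine h.trans ?_
    rw [hhalf, sin_pi_div_two_sub, cos_pi_div_two_sub, cos_pi_sub, neg_neg,
      sub_sub_cancel]
    ring
  · refine ContDiffAt.comp π (g := Ψ) ?_ (contDiffAt_const.sub contDiffAt_id)
    simpa using hsmooth
  · simpa using heven t
  · simp [iteratedDeriv_comp_const_sub, iteratedDeriv_odd_eq_zero_of_even heven k]
  · simp [hΨ, psiExtension_zero]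
  · have h := iteratedDeriv_two_psiExtension β α (hneg.of_le h2)
    rw [derivWithin_comp_neg] at h
    simp only [iteratedDeriv_comp_const_sub, sub_self]
    rw [hΨ, h]
    simp
    ring
end
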